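/- Let K be a field and let Γ = (R,S) and Γ' = (R',S') be finite binary relations. Then the K-linearizations K(Γ) and K(Γ') are isomorphic as transformation-pairs if and only if the following three conditions all hold: (1) γ_{i,j}(Γ) = γ_{i,j}(Γ') for all natural numbers i, j with |i − j| ≤ 2; (2) the C-stabilizations C^{∞,∞}(Γ) and C^{∞,∞}(Γ') are graph-isomorphic (equivalently, they have the same decompositions into pieces of types L_N and C_N); and (3) #R = #R'. -/

import Mathlib

open Polynomial

namespace Towber

/-- A transformation-pair over `K`: two `K`-linear maps between
finite-dimensional `K`-vector spaces. -/
structure Pair (K : Type) [Field K] where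
  E : Type
  V : Type
  [addE : AddCommGroup E]
  [modE : Module K E]
  [finE : FiniteDimensional K E]
  [addV : AddCommGroup V]
  [modV : Module K V]
  [finV : FiniteDimensional K V]
  mu : E →ₗ[K] V
  nu : E →ₗ[K] V

attribute [instance] Pair.addE Pair.modE Pair.finE Pair.addV Pair.modV Pair.finV

variable (K : Type) [Field K]

/-- Isomorphism of transformation-pairs. -/
def Pair.Iso (τ σ : Pair K) : Prop :=
  ∃ (α : τ.E ≃ₗ[K] σ.E) (β : τ.V ≃ₗ[K] σ.V),
    (∀ x, σ.mu (α x) = β (τ.mu x)) ∧ (∀ x, σ.nu (α x) = β (τ.nu x))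

/-- Finite direct sum of transformation-pairs. -/
noncomputable def dSum (ι : Type) [Finite ι] (τ : ι → Pair K) : Pair K :=
  letI := Fintype.ofFinite ι
  { E := ∀ i, (τ i).E
    V := ∀ i, (τ i).V
    mu := LinearMap.pi fun i => (τ i).mu ∘ₗ LinearMap.proj i
    nu := LinearMap.pi fun i => (τ i).nu ∘ₗ LinearMap.proj i }

/-- Binary direct sum of transformation-pairs. -/
noncomputable def dSum2 (τ σ : Pair K) : Pair K where
  E := τ.E × σ.E
  V := τ.V × σ.V
  mu := τ.mu.prodMap σ.mu
  nu := τ.nu.prodMap σ.nu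

/-- A transformation-pair built from a pair of matrices. -/
noncomputable def ofMats {a b : ℕ} (M N : Matrix (Fin b) (Fin a) K) : Pair K where
  E := Fin a → K
  V := Fin b → K
  mu := Matrix.toLin' M
  nu := Matrix.toLin' N

/-- `^0T_n = [μ_n, I : K^n → K^n]`, where `μ_n` maps `f_i ↦ f_{i+1}`, `f_n ↦ 0`. -/
noncomputable def zT (n : ℕ) : Pair K :=
  ofMats K (Matrix.of fun j i : Fin n => if (i : ℕ) + 1 = (j : ℕ) then 1 else 0) 1

/-- `T^0_n = [I, μ_n : K^n → K^n]`. -/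
noncomputable def Tz (n : ℕ) : Pair K :=
  ofMats K 1 (Matrix.of fun j i : Fin n => if (i : ℕ) + 1 = (j : ℕ) then 1 else 0)

/-- `T_n = [κ_n, λ_n : K^n → K^{n+1}]`, `κ_n : f_i ↦ f_i`, `λ_n : f_i ↦ f_{i+1}`. -/
noncomputable def Tn (n : ℕ) : Pair K :=
  ofMats K (Matrix.of fun (j : Fin (n+1)) (i : Fin n) => if (j : ℕ) = (i : ℕ) then 1 else 0)
    (Matrix.of fun (j : Fin (n+1)) (i : Fin n) => if (j : ℕ) = (i : ℕ) + 1 then 1 else 0)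

/-- `^0T^0_n = [κ'_n, λ'_n : K^{n+1} → K^n]`. -/
noncomputable def zTz (n : ℕ) : Pair K :=
  ofMats K (Matrix.of fun (j : Fin n) (i : Fin (n+1)) => if (j : ℕ) = (i : ℕ) then 1 else 0)
    (Matrix.of fun (j : Fin n) (i : Fin (n+1)) => if (j : ℕ) + 1 = (i : ℕ) then 1 else 0)

/-- `S(F) = [·X, I : K[X]/(F) → K[X]/(F)]` for a nonzero polynomial `F`. -/
noncomputable def SP (F : Polynomial K) (hF : F ≠ 0) : Pair K :=
  letI : FiniteDimensional K (AdjoinRoot F) := (AdjoinRoot.powerBasis hF).finite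
  { E := AdjoinRoot F
    V := AdjoinRoot F
    mu := LinearMap.mulLeft K (AdjoinRoot.root F)
    nu := LinearMap.id }

/-- Membership in Kronecker's list `L(K)` (up to isomorphism). -/
def IsKron (σ : Pair K) : Prop :=
  (∃ n, 1 ≤ n ∧ Pair.Iso K σ (zT K n)) ∨
  (∃ n, 1 ≤ n ∧ Pair.Iso K σ (Tz K n)) ∨
  (∃ n, Pair.Iso K σ (Tn K n)) ∨
  (∃ n, Pair.Iso K σ (zTz K n)) ∨
  (∃ (p : Polynomial K) (n : ℕ), p.Monic ∧ Irreducible p ∧ p ≠ X ∧ 1 ≤ n ∧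
    ∃ h : p ^ n ≠ 0, Pair.Iso K σ (SP K (p ^ n) h))

/-- Being of type `S(p^n)` with `p` monic irreducible, `p ≠ X`, `n ≥ 1`. -/
def IsSType (σ : Pair K) : Prop :=
  ∃ (p : Polynomial K) (n : ℕ), p.Monic ∧ Irreducible p ∧ p ≠ X ∧ 1 ≤ n ∧
    ∃ h : p ^ n ≠ 0, Pair.Iso K σ (SP K (p ^ n) h)

/-- Membership in Weierstrass' (regular) part of Kronecker's list. -/
def IsKronReg (σ : Pair K) : Prop :=
  (∃ n, 1 ≤ n ∧ Pair.Iso K σ (zT K n)) ∨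
  (∃ n, 1 ≤ n ∧ Pair.Iso K σ (Tz K n)) ∨
  (∃ (p : Polynomial K) (n : ℕ), p.Monic ∧ Irreducible p ∧ p ≠ X ∧ 1 ≤ n ∧
    ∃ h : p ^ n ≠ 0, Pair.Iso K σ (SP K (p ^ n) h))

/-- A finite binary relation `(R, S)`. -/
structure BRel where
  S : Type
  R : S → S → Prop
  [fin : Finite S]

attribute [instance] BRel.fin

/-- The generating relation for left contraction:
`y ~ y'` whenever `∃ x, xRy ∧ xRy'`. -/
def BRel.lgen (Γ : BRel) : Γ.S → Γ.S → Prop := fun y y' => ∃ x, Γ.R x y ∧ Γ.R x y'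

/-- The generating relation for right contraction:
`x ~ x'` whenever `∃ y, xRy ∧ x'Ry`. -/
def BRel.rgen (Γ : BRel) : Γ.S → Γ.S → Prop := fun x x' => ∃ y, Γ.R x y ∧ Γ.R x' y

/-- Quotient of a binary relation by (the equivalence relation generated by) `r`:
two classes are related iff some representatives are related. -/
def BRel.quotBy (Γ : BRel) (r : Γ.S → Γ.S → Prop) : BRel where
  S := Quot r
  R := fun α β => ∃ a b, Quot.mk r a = α ∧ Quot.mk r b = β ∧ Γ.R a b

/-- Left contraction `C_l Γ`. -/
def BRel.Cl (Γ : BRel) : BRel := Γ.quotBy Γ.lgen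

/-- Right contraction `C_r Γ`. -/
def BRel.Cr (Γ : BRel) : BRel := Γ.quotBy Γ.rgen

/-- Graph-isomorphism of binary relations. -/
def BRel.Iso (Γ Δ : BRel) : Prop :=
  ∃ φ : Γ.S ≃ Δ.S, ∀ a b, Δ.R (φ a) (φ b) ↔ Γ.R a b

/-- `γ_{m,n}(Γ)`, the number of vertices of `C_l^m C_r^n Γ`. -/
noncomputable def BRel.gamma (Γ : BRel) (m n : ℕ) : ℕ :=
  Nat.card ((BRel.Cl^[m] (BRel.Cr^[n] Γ)).S)

/-- `Γ` has stabilized at `N`: for all `m, n ≥ N` the iterated contraction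
`C_l^m C_r^n Γ` is graph-isomorphic to `C_l^N C_r^N Γ`. -/
def BRel.StabAt (Γ : BRel) (N : ℕ) : Prop :=
  ∀ m, N ≤ m → ∀ n, N ≤ n →
    BRel.Iso (BRel.Cl^[m] (BRel.Cr^[n] Γ)) (BRel.Cl^[N] (BRel.Cr^[N] Γ))

/-- Number of edges of a binary relation. -/
noncomputable def BRel.edges (Γ : BRel) : ℕ :=
  Nat.card {p : Γ.S × Γ.S // Γ.R p.1 p.2}

/-- The `K`-linearization of a finite binary relation. -/
noncomputable def BRel.linz (Γ : BRel) : Pair K :=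
  letI := Fintype.ofFinite Γ.S
  letI := Classical.decEq Γ.S
  letI : DecidablePred (fun p : Γ.S × Γ.S => Γ.R p.1 p.2) := Classical.decPred _
  { E := {p : Γ.S × Γ.S // Γ.R p.1 p.2} → K
    V := Γ.S → K
    mu := Matrix.toLin' (Matrix.of fun (v : Γ.S) (e : {p : Γ.S × Γ.S // Γ.R p.1 p.2}) =>
      if e.1.1 = v then 1 else 0)
    nu := Matrix.toLin' (Matrix.of fun (v : Γ.S) (e : {p : Γ.S × Γ.S // Γ.R p.1 p.2}) =>
      if e.1.2 = v then 1 else 0) }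

/-- The disjoint union of the paths `L_{m i}` (on `m i` vertices) and the
cycles `C_{c j}` (on `c j` vertices). -/
def modelGraph (p q : ℕ) (m : Fin p → ℕ) (c : Fin q → ℕ) : BRel where
  S := (Σ i, Fin (m i)) ⊕ (Σ j, Fin (c j))
  R := fun x y =>
    (∃ (i : Fin p) (a b : Fin (m i)),
        x = Sum.inl ⟨i, a⟩ ∧ y = Sum.inl ⟨i, b⟩ ∧ (b : ℕ) = (a : ℕ) + 1) ∨
    (∃ (j : Fin q) (a b : Fin (c j)),
        x = Sum.inr ⟨j, a⟩ ∧ y = Sum.inr ⟨j, b⟩ ∧ (b : ℕ) = ((a : ℕ) + 1) % (c j))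

/-- A finite directed graph, possibly with parallel edges. -/
structure DiGraph where
  E : Type
  V : Type
  [finE : Finite E]
  [finV : Finite V]
  init : E → V
  term : E → V

attribute [instance] DiGraph.finE DiGraph.finV

/-- The parallelism relation on the edges of a directed graph. -/
def DiGraph.par (G : DiGraph) : G.E → G.E → Prop :=
  fun e e' => G.init e = G.init e' ∧ G.term e = G.term e'

/-- The reduced form of a directed graph: edges are parallelism classes. -/
def DiGraph.red (G : DiGraph) : DiGraph where
  E := Quot G.par
  V := G.V
  init := Quot.lift G.init fun _ _ h => h.1
  term := Quot.lift G.term fun _ _ h => h.2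

/-- The `K`-linearization of a finite directed graph. -/
noncomputable def DiGraph.linz (G : DiGraph) : Pair K :=
  letI := Fintype.ofFinite G.E
  letI := Fintype.ofFinite G.V
  letI := Classical.decEq G.V
  letI := Classical.decEq G.E
  { E := G.E → K
    V := G.V → K
    mu := Matrix.toLin' (Matrix.of fun (v : G.V) (e : G.E) => if G.init e = v then 1 else 0)
    nu := Matrix.toLin' (Matrix.of fun (v : G.V) (e : G.E) => if G.term e = v then 1 else 0) }

section LinearAlgebra

variable {K}

/-- An injective linear map on a subspace that is compatible with two surjections extends to a
linear equivalence compatible with these surjections. -/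
theorem exists_linearEquiv_extend {V V' Q : Type} [AddCommGroup V] [Module K V]
    [AddCommGroup V'] [Module K V'] [AddCommGroup Q] [Module K Q]
    [FiniteDimensional K V] [FiniteDimensional K V'] (p : V →ₗ[K] Q) (p' : V' →ₗ[K] Q)
    (hp : Function.Surjective p) (hp' : Function.Surjective p') (D : Submodule K V)
    (α : D →ₗ[K] V') (hα : Function.Injective α) (hpα : ∀ d : D, p' (α d) = p d)
    (hdim : Module.finrank K V = Module.finrank K V') :
    ∃ β : V ≃ₗ[K] V', (∀ x, p' (β x) = p x) ∧ ∀ d : D, β d = α d := by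
  obtain ⟨π, hπ⟩ := D.subtype.exists_leftInverse_of_injective (by simp)
  obtain ⟨s, hs⟩ := p'.exists_rightInverse_of_surjective (LinearMap.range_eq_top.2 hp')
  have hπ' : ∀ d : D, π d = d := fun d => LinearMap.congr_fun hπ d
  have hs' : ∀ q, p' (s q) = q := fun q => LinearMap.congr_fun hs q
  set β₀ : V →ₗ[K] V' := α ∘ₗ π + s ∘ₗ p ∘ₗ (LinearMap.id - D.subtype ∘ₗ π) with hβ₀
  have hβD : ∀ d : D, β₀ d = α d := by
    intro d
    simp [hβ₀, hπ']
  have hβp : ∀ x, p' (β₀ x) = p x := by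
    intro x
    simp [hβ₀, hs', hpα]
  have hND : Disjoint D (LinearMap.ker β₀) := by
    rw [Submodule.disjoint_def]
    intro x hx hx0
    have h1 : α ⟨x, hx⟩ = 0 := by rw [← hβD]; exact hx0
    have h2 := hα (h1.trans (map_zero α).symm)
    exact congrArg Subtype.val h2
  obtain ⟨C, hDC, hC⟩ := hND.exists_isCompl
  have hcod : Codisjoint (LinearMap.ker p') (LinearMap.range β₀) := by
    rw [codisjoint_iff, eq_top_iff]
    intro v _
    obtain ⟨x, hx⟩ := hp (p' v)
    rw [Submodule.mem_sup]
    refine ⟨v - β₀ x, ?_, β₀ x, ⟨x, rfl⟩, by abel⟩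
    simp [hβp, hx]
  obtain ⟨M, hML, hM⟩ := hcod.exists_isCompl
  have hfr : Module.finrank K (LinearMap.ker β₀) = Module.finrank K M := by
    have h1 := Submodule.finrank_add_eq_of_isCompl hM
    have h2 := LinearMap.finrank_range_add_finrank_ker β₀
    omega
  let γ := LinearEquiv.ofFinrankEq (R := K) _ _ hfr
  let pr := Submodule.projectionOnto (LinearMap.ker β₀) C hC.symm
  have hpr : ∀ n : LinearMap.ker β₀, pr n = n := fun n =>
    Submodule.projectionOnto_apply_left hC.symm n
  have hprD : ∀ d : D, pr d = 0 := fun d =>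
    (Submodule.projectionOnto_apply_eq_zero_iff hC.symm).2 (hDC d.2)
  let β₁ : V →ₗ[K] V' := β₀ + M.subtype ∘ₗ γ.toLinearMap ∘ₗ pr
  have hinj : Function.Injective β₁ := by
    rw [injective_iff_map_eq_zero]
    intro x hx
    have hx' : β₀ x + (γ (pr x) : V') = 0 := hx
    have h0 : β₀ x = 0 := by
      refine Submodule.disjoint_def.1 hM.disjoint _ ?_ ⟨x, rfl⟩
      rw [eq_neg_of_add_eq_zero_left hx']
      exact M.neg_mem (γ (pr x)).2
    rw [h0, zero_add] at hx'
    have h1 : γ (pr x) = 0 := Subtype.ext hx'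
    have h2 : pr x = 0 := by simpa using h1
    have h3 := hpr ⟨x, h0⟩
    rw [h2] at h3
    exact (congrArg Subtype.val h3).symm
  refine ⟨β₁.linearEquivOfInjective hinj hdim, ?_, ?_⟩
  · intro x
    have h : p' (γ (pr x) : V') = 0 := hML (γ (pr x)).2
    change p' (β₀ x + (γ (pr x) : V')) = p x
    rw [map_add, h, hβp, add_zero]
  · intro d
    change β₀ d + (γ (pr d) : V') = α d
    rw [hprD, hβD]
    simp

/-- Two surjections from spaces of equal dimension differ by a linear equivalence. -/
theorem exists_linearEquiv_lift {V V' Q : Type} [AddCommGroup V] [Module K V]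
    [AddCommGroup V'] [Module K V'] [AddCommGroup Q] [Module K Q]
    [FiniteDimensional K V] [FiniteDimensional K V'] (p : V →ₗ[K] Q) (p' : V' →ₗ[K] Q)
    (hp : Function.Surjective p) (hp' : Function.Surjective p')
    (hdim : Module.finrank K V = Module.finrank K V') :
    ∃ β : V ≃ₗ[K] V', ∀ x, p' (β x) = p x := by
  obtain ⟨β, hβ, -⟩ := exists_linearEquiv_extend p p' hp hp' ⊥ 0
    (Function.injective_of_subsingleton _) (by
      rintro ⟨d, hd⟩
      obtain rfl := (Submodule.mem_bot K).1 hd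
      simp) hdim
  exact ⟨β, hβ⟩

/-- A linear equivalence matching the kernels of two surjections descends to their targets. -/
theorem exists_linearEquiv_descend {V V' Q Q' : Type} [AddCommGroup V] [Module K V]
    [AddCommGroup V'] [Module K V'] [AddCommGroup Q] [Module K Q] [AddCommGroup Q'] [Module K Q']
    (p : V →ₗ[K] Q) (p' : V' →ₗ[K] Q') (hp : Function.Surjective p)
    (hp' : Function.Surjective p') (β : V ≃ₗ[K] V') (h : ∀ x, p' (β x) = 0 ↔ p x = 0) :
    ∃ β' : Q ≃ₗ[K] Q', ∀ x, β' (p x) = p' (β x) := by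
  have hk : (LinearMap.ker p).map (β : V →ₗ[K] V') = LinearMap.ker p' := by
    ext y
    constructor
    · rintro ⟨x, hx, rfl⟩
      exact (h x).2 hx
    · intro hy
      exact ⟨β.symm y, (h _).1 (by simpa using hy), by simp⟩
  refine ⟨(p.quotKerEquivOfSurjective hp).symm ≪≫ₗ Submodule.Quotient.equiv _ _ β hk ≪≫ₗ
    p'.quotKerEquivOfSurjective hp', fun x => ?_⟩
  have h1 : (p.quotKerEquivOfSurjective hp).symm (p x) = Submodule.Quotient.mk x := by
    rw [LinearEquiv.symm_apply_eq]
    rfl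
  simp only [LinearEquiv.trans_apply, h1]
  rfl

/-- A linear equivalence matching the ranges of two injections restricts to their sources. -/
theorem exists_linearEquiv_restrict {V V' Q Q' : Type} [AddCommGroup V] [Module K V]
    [AddCommGroup V'] [Module K V'] [AddCommGroup Q] [Module K Q] [AddCommGroup Q'] [Module K Q']
    (i : Q →ₗ[K] V) (i' : Q' →ₗ[K] V') (hi : Function.Injective i)
    (hi' : Function.Injective i') (β : V ≃ₗ[K] V')
    (h : ∀ x, β x ∈ LinearMap.range i' ↔ x ∈ LinearMap.range i) :
    ∃ β' : Q ≃ₗ[K] Q', ∀ x, i' (β' x) = β (i x) := by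
  have hk : (LinearMap.range i).map (β : V →ₗ[K] V') = LinearMap.range i' := by
    ext y
    constructor
    · rintro ⟨x, hx, rfl⟩
      exact (h x).2 hx
    · intro hy
      exact ⟨β.symm y, (h _).1 (by simpa using hy), by simp⟩
  refine ⟨LinearEquiv.ofInjective i hi ≪≫ₗ β.ofSubmodules _ _ hk ≪≫ₗ
    (LinearEquiv.ofInjective i' hi').symm, fun x => ?_⟩
  have h1 := (LinearEquiv.ofInjective i' hi').apply_symm_apply
    (β.ofSubmodules _ _ hk (LinearEquiv.ofInjective i hi x))
  exact congrArg Subtype.val h1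

/-- The set of `y` with `(0, y)` in the linear relation `A`. -/
def leftKer {V : Type} [AddCommGroup V] [Module K V] (A : Submodule K (V × V)) :
    Submodule K V := A.comap (LinearMap.inr K V V)

/-- The set of `x` with `(x, 0)` in the linear relation `A`. -/
def rightKer {V : Type} [AddCommGroup V] [Module K V] (A : Submodule K (V × V)) :
    Submodule K V := A.comap (LinearMap.inl K V V)

theorem mem_leftKer {V : Type} [AddCommGroup V] [Module K V] {A : Submodule K (V × V)} {y : V} :
    y ∈ leftKer A ↔ ((0, y) : V × V) ∈ A := Iff.rfl

theorem mem_rightKer {V : Type} [AddCommGroup V] [Module K V] {A : Submodule K (V × V)} {x : V} :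
    x ∈ rightKer A ↔ ((x, 0) : V × V) ∈ A := Iff.rfl

/-- Contracting the left kernel of a linear relation factors through the image `B` of the
relation in `V × Q`; the dimensions of `B` and of the image in `Q × Q` are related through the
right kernels. -/
theorem finrank_map_id_prodMap {V Q : Type} [AddCommGroup V] [Module K V] [AddCommGroup Q]
    [Module K Q] [FiniteDimensional K V] [FiniteDimensional K Q] (p : V →ₗ[K] Q)
    (A : Submodule K (V × V)) (hk : LinearMap.ker p = leftKer A) :
    Module.finrank K (A.map (LinearMap.id.prodMap p)) +
        Module.finrank K (rightKer (A.map (p.prodMap p))) =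
      Module.finrank K (A.map (p.prodMap p)) + Module.finrank K (rightKer A) := by
  have hk' : ∀ y, p y = 0 ↔ ((0, y) : V × V) ∈ A := fun y => by
    rw [← LinearMap.mem_ker, hk, mem_leftKer]
  have h1 : (A.map (LinearMap.id.prodMap p)).map (p.prodMap LinearMap.id) =
      A.map (p.prodMap p) := by
    rw [← Submodule.map_comp]
    rfl
  have h2 : (rightKer A).map p = rightKer (A.map (p.prodMap p)) := by
    ext q
    constructor
    · rintro ⟨x, hx, rfl⟩
      exact ⟨(x, 0), hx, by simp⟩
    · rintro ⟨⟨x, y⟩, hxy, h⟩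
      simp only [LinearMap.prodMap_apply, LinearMap.inl_apply, Prod.mk.injEq] at h
      refine ⟨x, ?_, h.1⟩
      have := A.sub_mem hxy ((hk' y).1 h.2)
      simpa [rightKer] using this
  have e1 := LinearMap.finrank_range_add_finrank_ker
    ((p.prodMap LinearMap.id).domRestrict (A.map (LinearMap.id.prodMap p)))
  have e2 := LinearMap.finrank_range_add_finrank_ker (p.domRestrict (rightKer A))
  rw [LinearMap.range_domRestrict, h1] at e1
  rw [LinearMap.range_domRestrict, h2] at e2
  have e3 : Module.finrank K (LinearMap.ker (p.domRestrict (rightKer A))) =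
      Module.finrank K (LinearMap.ker
        ((p.prodMap (LinearMap.id : Q →ₗ[K] Q)).domRestrict
          (A.map (LinearMap.id.prodMap p)))) := by
    have hmem : ∀ x : V, x ∈ rightKer A → ((x, (0 : Q)) : V × Q) ∈
        A.map (LinearMap.id.prodMap p) := fun x hx => ⟨(x, 0), hx, by simp⟩
    refine LinearEquiv.finrank_eq (LinearEquiv.ofBijective
      (LinearMap.codRestrict _ ((LinearMap.codRestrict _
        (LinearMap.inl K V Q ∘ₗ (rightKer A).subtype) fun x => hmem x x.2) ∘ₗ
          (LinearMap.ker (p.domRestrict (rightKer A))).subtype) ?_) ⟨?_, ?_⟩)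
    · rintro ⟨x, hx⟩
      have hx' : p x = 0 := hx
      exact Prod.ext hx' rfl
    · rintro ⟨⟨x, hx⟩, hx'⟩ ⟨⟨y, hy⟩, hy'⟩ h
      have : x = y := congrArg (fun z => z.1.1.1) h
      subst this
      rfl
    · rintro ⟨⟨⟨x, q⟩, ⟨⟨a, b⟩, hab, h⟩⟩, hk0⟩
      have hk1 : p x = 0 ∧ q = 0 := by simpa using hk0
      obtain ⟨hx, rfl⟩ := hk1
      have h' : a = x ∧ p b = 0 := by simpa using h
      obtain ⟨rfl, hb⟩ := h'
      have ha : a ∈ rightKer A := by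
        have := A.sub_mem hab ((hk' b).1 hb)
        simpa [rightKer] using this
      exact ⟨⟨⟨a, ha⟩, hx⟩, rfl⟩
  omega

/-- An isomorphism of the contractions of two linear relations by their left kernels lifts,
provided that the ambient spaces and the right kernels have the same dimensions. -/
theorem exists_linearEquiv_of_contraction {V V' Q Q' : Type} [AddCommGroup V] [Module K V]
    [AddCommGroup V'] [Module K V'] [AddCommGroup Q] [Module K Q] [AddCommGroup Q'] [Module K Q']
    [FiniteDimensional K V] [FiniteDimensional K V'] [FiniteDimensional K Q]
    [FiniteDimensional K Q'] (p : V →ₗ[K] Q) (p' : V' →ₗ[K] Q') (hp : Function.Surjective p)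
    (hp' : Function.Surjective p') (A : Submodule K (V × V)) (A' : Submodule K (V' × V'))
    (hk : LinearMap.ker p = leftKer A) (hk' : LinearMap.ker p' = leftKer A') (φ : Q ≃ₗ[K] Q')
    (hφ : ∀ x y, (φ x, φ y) ∈ A'.map (p'.prodMap p') ↔ (x, y) ∈ A.map (p.prodMap p))
    (hdim : Module.finrank K V = Module.finrank K V')
    (hdim' : Module.finrank K (rightKer A) = Module.finrank K (rightKer A')) :
    ∃ β : V ≃ₗ[K] V', ∀ x y, (β x, β y) ∈ A' ↔ (x, y) ∈ A := by
  have hmap : (A.map (p.prodMap p)).map (φ.toLinearMap.prodMap φ.toLinearMap) =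
      A'.map (p'.prodMap p') := by
    ext ⟨x, y⟩
    constructor
    · rintro ⟨⟨a, b⟩, hab, h⟩
      rw [← h]
      exact (hφ a b).2 hab
    · intro h
      refine ⟨(φ.symm x, φ.symm y), (hφ _ _).1 (by simpa using h), by simp⟩
  have hfrA : Module.finrank K (A.map (p.prodMap p)) =
      Module.finrank K (A'.map (p'.prodMap p')) := by
    rw [← hmap]
    exact (LinearEquiv.finrank_map_eq (φ.prodCongr φ) _).symm
  have hfrR : Module.finrank K (rightKer (A.map (p.prodMap p))) =
      Module.finrank K (rightKer (A'.map (p'.prodMap p'))) := by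
    have : (rightKer (A.map (p.prodMap p))).map φ.toLinearMap =
        rightKer (A'.map (p'.prodMap p')) := by
      ext x
      constructor
      · rintro ⟨a, ha, rfl⟩
        have := (hφ a 0).2 ha
        rw [map_zero] at this
        exact this
      · intro h
        refine ⟨φ.symm x, (hφ (φ.symm x) 0).1 ?_, by simp⟩
        rw [map_zero, LinearEquiv.apply_symm_apply]
        exact h
    rw [← this]
    exact (LinearEquiv.finrank_map_eq φ _).symm
  have f1 := finrank_map_id_prodMap p A hk
  have f2 := finrank_map_id_prodMap p' A' hk'
  set B := A.map (LinearMap.id.prodMap p) with hB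
  set B' := A'.map (LinearMap.id.prodMap p') with hB'
  have hkA : ∀ y, p y = 0 ↔ ((0, y) : V × V) ∈ A := fun y => by
    rw [← LinearMap.mem_ker, hk, mem_leftKer]
  have hkA' : ∀ y, p' y = 0 ↔ ((0, y) : V' × V') ∈ A' := fun y => by
    rw [← LinearMap.mem_ker, hk', mem_leftKer]
  have hAB : ∀ x y, (x, p y) ∈ B ↔ (x, y) ∈ A := by
    intro x y
    constructor
    · rintro ⟨⟨a, b⟩, hab, h⟩
      have h' : a = x ∧ p b = p y := by simpa using h
      obtain ⟨rfl, hb⟩ := h'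
      have := A.sub_mem hab ((hkA (b - y)).1 (by simp [hb]))
      simpa using this
    · intro h
      exact ⟨(x, y), h, by simp⟩
  have hAB' : ∀ x y, (x, p' y) ∈ B' ↔ (x, y) ∈ A' := by
    intro x y
    constructor
    · rintro ⟨⟨a, b⟩, hab, h⟩
      have h' : a = x ∧ p' b = p' y := by simpa using h
      obtain ⟨rfl, hb⟩ := h'
      have := A'.sub_mem hab ((hkA' (b - y)).1 (by simp [hb]))
      simpa using this
    · intro h
      exact ⟨(x, y), h, by simp⟩
  have hinj : Function.Injective ((LinearMap.fst K V Q).domRestrict B) := by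
    rw [injective_iff_map_eq_zero]
    rintro ⟨⟨x, q⟩, hxq⟩ hx
    have hx' : x = 0 := hx
    obtain ⟨y, rfl⟩ := hp q
    subst hx'
    have := (hkA y).2 ((hAB 0 y).1 hxq)
    simp [this]
  have hinj' : Function.Injective ((LinearMap.fst K V' Q').domRestrict B') := by
    rw [injective_iff_map_eq_zero]
    rintro ⟨⟨x, q⟩, hxq⟩ hx
    have hx' : x = 0 := hx
    obtain ⟨y, rfl⟩ := hp' q
    subst hx'
    have := (hkA' y).2 ((hAB' 0 y).1 hxq)
    simp [this]
  have hmB : ∀ b : B, (φ.toLinearMap.prodMap φ.toLinearMap) (p b.1.1, b.1.2) ∈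
      A'.map (p'.prodMap p') := by
    rintro ⟨⟨x, q⟩, hxq⟩
    obtain ⟨y, rfl⟩ := hp q
    rw [← hmap]
    exact ⟨_, ⟨(x, y), (hAB x y).1 hxq, rfl⟩, rfl⟩
  have hmB' : ∀ b : B', (p' b.1.1, b.1.2) ∈ A'.map (p'.prodMap p') := by
    rintro ⟨⟨x, q⟩, hxq⟩
    obtain ⟨y, rfl⟩ := hp' q
    exact ⟨(x, y), (hAB' x y).1 hxq, rfl⟩
  obtain ⟨α, hα⟩ := exists_linearEquiv_lift
    (LinearMap.codRestrict (A'.map (p'.prodMap p')) ((φ.toLinearMap.prodMap φ.toLinearMap) ∘ₗ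
      (p.prodMap LinearMap.id) ∘ₗ B.subtype) hmB)
    (LinearMap.codRestrict (A'.map (p'.prodMap p'))
      ((p'.prodMap LinearMap.id) ∘ₗ B'.subtype) hmB')
    (by
      rintro ⟨q, hq⟩
      rw [← hmap] at hq
      obtain ⟨_, ⟨⟨x, y⟩, hxy, rfl⟩, rfl⟩ := hq
      exact ⟨⟨(x, p y), (hAB x y).2 hxy⟩, rfl⟩)
    (by
      rintro ⟨_, ⟨⟨x, y⟩, hxy, rfl⟩⟩
      exact ⟨⟨(x, p' y), (hAB' x y).2 hxy⟩, rfl⟩) (by omega)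
  have hα1 : ∀ b : B, p' (α b).1.1 = φ (p b.1.1) := fun b =>
    congrArg (fun z => z.1.1) (hα b)
  have hα2 : ∀ b : B, (α b).1.2 = φ b.1.2 := fun b =>
    congrArg (fun z => z.1.2) (hα b)
  let e := LinearEquiv.ofInjective _ hinj
  have he : ∀ b : B, ((e b : LinearMap.range _) : V) = b.1.1 := fun b => rfl
  obtain ⟨β, hβp, hβα⟩ := exists_linearEquiv_extend (φ.toLinearMap ∘ₗ p) p'
    (φ.surjective.comp hp) hp' _
    ((LinearMap.fst K V' Q').domRestrict B' ∘ₗ α.toLinearMap ∘ₗ e.symm.toLinearMap)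
    ((hinj'.comp α.injective).comp e.symm.injective)
    (by
      intro d
      obtain ⟨b, rfl⟩ := e.surjective d
      simp only [LinearMap.coe_comp, Function.comp_apply, LinearEquiv.coe_coe,
        LinearEquiv.symm_apply_apply]
      rw [he]
      exact hα1 b) hdim
  have hβα' : ∀ b : B, β b.1.1 = (α b).1.1 := by
    intro b
    have := hβα (e b)
    rw [he] at this
    simpa using this
  have hβp' : ∀ x, p' (β x) = φ (p x) := hβp
  refine ⟨β, fun x y => ⟨fun h => ?_, fun h => ?_⟩⟩
  · obtain ⟨b, hb⟩ := α.surjective ⟨_, (hAB' _ _).2 h⟩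
    have h1 : b.1.1 = x := by
      apply β.injective
      rw [hβα', hb]
    have h2 : b.1.2 = p y := by
      apply φ.injective
      rw [← hα2, hb, ← hβp']
    rw [← hAB, ← h1, ← h2]
    exact b.2
  · have h1 := hβα' ⟨_, (hAB _ _).2 h⟩
    have h2 := hα2 ⟨_, (hAB _ _).2 h⟩
    have h3 := (α ⟨_, (hAB _ _).2 h⟩).2
    rw [← hAB', hβp']
    convert h3 using 1
    exact Prod.ext h1 h2.symm

end LinearAlgebra
section Relations

/-- The opposite of a binary relation. -/
def BRel.op (Γ : BRel) : BRel where
  S := Γ.S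
  R := fun a b => Γ.R b a

theorem BRel.Iso.refl (Γ : BRel) : BRel.Iso Γ Γ := ⟨Equiv.refl _, fun _ _ => Iff.rfl⟩

theorem BRel.Iso.symm {Γ Δ : BRel} (h : BRel.Iso Γ Δ) : BRel.Iso Δ Γ := by
  obtain ⟨φ, hφ⟩ := h
  exact ⟨φ.symm, fun a b => by rw [← hφ]; simp⟩

theorem BRel.Iso.trans {Γ Δ Θ : BRel} (h : BRel.Iso Γ Δ) (h' : BRel.Iso Δ Θ) :
    BRel.Iso Γ Θ := by
  obtain ⟨φ, hφ⟩ := h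
  obtain ⟨ψ, hψ⟩ := h'
  exact ⟨φ.trans ψ, fun a b => by simp [hφ, hψ]⟩

theorem BRel.Iso.op {Γ Δ : BRel} (h : BRel.Iso Γ Δ) : BRel.Iso Γ.op Δ.op := by
  obtain ⟨φ, hφ⟩ := h
  exact ⟨φ, fun a b => hφ b a⟩

theorem BRel.Iso.card_eq {Γ Δ : BRel} (h : BRel.Iso Γ Δ) : Nat.card Γ.S = Nat.card Δ.S :=
  Nat.card_congr h.choose

theorem BRel.Iso.Cl {Γ Δ : BRel} (h : BRel.Iso Γ Δ) : BRel.Iso Γ.Cl Δ.Cl := by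
  obtain ⟨φ, hφ⟩ := h
  have hl : ∀ a b, Γ.lgen a b ↔ Δ.lgen (φ a) (φ b) := by
    intro a b
    constructor
    · rintro ⟨x, h1, h2⟩
      exact ⟨φ x, (hφ _ _).2 h1, (hφ _ _).2 h2⟩
    · rintro ⟨x, h1, h2⟩
      obtain ⟨x, rfl⟩ := φ.surjective x
      exact ⟨x, (hφ _ _).1 h1, (hφ _ _).1 h2⟩
  refine ⟨Quot.congr φ hl, ?_⟩
  rintro ⟨a⟩ ⟨b⟩
  constructor
  · rintro ⟨x, y, hx, hy, hR⟩
    obtain ⟨x, rfl⟩ := φ.surjective x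
    obtain ⟨y, rfl⟩ := φ.surjective y
    exact ⟨x, y, (Quot.congr φ hl).injective hx, (Quot.congr φ hl).injective hy, (hφ _ _).1 hR⟩
  · rintro ⟨x, y, hx, hy, hR⟩
    exact ⟨φ x, φ y, congrArg (Quot.congr φ hl) hx, congrArg (Quot.congr φ hl) hy,
      (hφ _ _).2 hR⟩

theorem BRel.Cr_iso_op (Γ : BRel) : BRel.Iso Γ.Cr Γ.op.Cl.op := by
  refine ⟨Equiv.refl _, fun α β => ?_⟩
  constructor
  · rintro ⟨a, b, ha, hb, h⟩
    exact ⟨b, a, hb, ha, h⟩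
  · rintro ⟨a, b, ha, hb, h⟩
    exact ⟨b, a, hb, ha, h⟩

theorem BRel.Iso.Cr {Γ Δ : BRel} (h : BRel.Iso Γ Δ) : BRel.Iso Γ.Cr Δ.Cr :=
  (Γ.Cr_iso_op.trans h.op.Cl.op).trans Δ.Cr_iso_op.symm

theorem BRel.mk_lgen_eq {Γ : BRel} {x a b : Γ.S} (ha : Γ.R x a) (hb : Γ.R x b) :
    Quot.mk Γ.lgen a = Quot.mk Γ.lgen b := Quot.sound ⟨x, ha, hb⟩

/-- Successors of vertices identified by the right contraction are identified by the left
contraction. -/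
theorem BRel.mk_lgen_eq_of_mk_rgen_eq {Γ : BRel} {x x' a b : Γ.S} (ha : Γ.R x a)
    (hb : Γ.R x' b) (h : Quot.mk Γ.rgen x = Quot.mk Γ.rgen x') :
    Quot.mk Γ.lgen a = Quot.mk Γ.lgen b := by
  let f : Γ.S → Prop := fun z => ∃ c, Γ.R z c ∧ Quot.mk Γ.lgen a = Quot.mk Γ.lgen c
  have hf : ∀ z z', Γ.rgen z z' → f z = f z' := by
    rintro z z' ⟨y, hy, hy'⟩
    apply propext
    constructor
    · rintro ⟨c, hc, e⟩
      exact ⟨y, hy', e.trans (BRel.mk_lgen_eq hc hy)⟩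
    · rintro ⟨c, hc, e⟩
      exact ⟨y, hy, e.trans (BRel.mk_lgen_eq hc hy')⟩
  have h1 : f x = f x' := congrArg (Quot.lift f hf) h
  have h2 : f x' := h1 ▸ ⟨a, ha, rfl⟩
  obtain ⟨c, hc, e⟩ := h2
  exact e.trans (BRel.mk_lgen_eq hc hb)

theorem BRel.mk_rgen_eq_of_mk_lgen_eq {Γ : BRel} {x x' a b : Γ.S} (ha : Γ.R a x)
    (hb : Γ.R b x') (h : Quot.mk Γ.lgen x = Quot.mk Γ.lgen x') :
    Quot.mk Γ.rgen a = Quot.mk Γ.rgen b :=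
  BRel.mk_lgen_eq_of_mk_rgen_eq (Γ := Γ.op) ha hb h

/-- The left and right contractions commute. -/
theorem BRel.Cr_Cl_iso (Γ : BRel) : BRel.Iso Γ.Cl.Cr Γ.Cr.Cl := by
  let f : Γ.Cl.Cr.S → Γ.Cr.Cl.S :=
    Quot.lift (Quot.lift (fun a => Quot.mk Γ.Cr.lgen (Quot.mk Γ.rgen a))
      (fun a b ⟨x, ha, hb⟩ => Quot.sound ⟨Quot.mk _ x, ⟨x, a, rfl, rfl, ha⟩,
        ⟨x, b, rfl, rfl, hb⟩⟩))
      (by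
        rintro ⟨a⟩ ⟨b⟩ ⟨y, ⟨a', y', ha', hy', hR'⟩, ⟨b', y'', hb', hy'', hR''⟩⟩
        have h1 : Quot.mk Γ.rgen a' = Quot.mk Γ.rgen b' :=
          BRel.mk_rgen_eq_of_mk_lgen_eq hR' hR'' (hy'.trans hy''.symm)
        let g : Γ.Cl.S → Γ.Cr.Cl.S := Quot.lift
          (fun a => Quot.mk Γ.Cr.lgen (Quot.mk Γ.rgen a))
          (fun a b ⟨x, ha, hb⟩ => Quot.sound ⟨Quot.mk _ x, ⟨x, a, rfl, rfl, ha⟩,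
            ⟨x, b, rfl, rfl, hb⟩⟩)
        have e1 := congrArg g ha'
        have e2 := congrArg g hb'
        exact e1.symm.trans ((congrArg (Quot.mk Γ.Cr.lgen) h1).trans e2))
  let g : Γ.Cr.Cl.S → Γ.Cl.Cr.S :=
    Quot.lift (Quot.lift (fun a => Quot.mk Γ.Cl.rgen (Quot.mk Γ.lgen a))
      (fun a b ⟨x, ha, hb⟩ => Quot.sound ⟨Quot.mk _ x, ⟨a, x, rfl, rfl, ha⟩,
        ⟨b, x, rfl, rfl, hb⟩⟩))
      (by
        rintro ⟨a⟩ ⟨b⟩ ⟨y, ⟨y', a', hy', ha', hR'⟩, ⟨y'', b', hy'', hb', hR''⟩⟩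
        have h1 : Quot.mk Γ.lgen a' = Quot.mk Γ.lgen b' :=
          BRel.mk_lgen_eq_of_mk_rgen_eq hR' hR'' (hy'.trans hy''.symm)
        let g : Γ.Cr.S → Γ.Cl.Cr.S := Quot.lift
          (fun a => Quot.mk Γ.Cl.rgen (Quot.mk Γ.lgen a))
          (fun a b ⟨x, ha, hb⟩ => Quot.sound ⟨Quot.mk _ x, ⟨a, x, rfl, rfl, ha⟩,
            ⟨b, x, rfl, rfl, hb⟩⟩)
        have e1 := congrArg g ha'
        have e2 := congrArg g hb'
        exact e1.symm.trans ((congrArg (Quot.mk Γ.Cl.rgen) h1).trans e2))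
  refine ⟨⟨f, g, ?_, ?_⟩, ?_⟩
  · rintro ⟨⟨a⟩⟩
    rfl
  · rintro ⟨⟨a⟩⟩
    rfl
  · intro a b
    constructor
    · rintro ⟨_, _, h1, h2, ⟨x, y, rfl, rfl, hR⟩⟩
      refine ⟨Quot.mk _ x, Quot.mk _ y, ?_, ?_, ⟨x, y, rfl, rfl, hR⟩⟩
      · have := congrArg g h1
        obtain ⟨⟨a⟩⟩ := a
        exact this
      · have := congrArg g h2
        obtain ⟨⟨b⟩⟩ := b
        exact this
    · rintro ⟨_, _, rfl, rfl, ⟨x, y, rfl, rfl, hR⟩⟩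
      exact ⟨_, _, rfl, rfl, ⟨x, y, rfl, rfl, hR⟩⟩

theorem BRel.Iso.iterate {F : BRel → BRel}
    (hF : ∀ {Γ Δ : BRel}, BRel.Iso Γ Δ → BRel.Iso (F Γ) (F Δ)) {Γ Δ : BRel}
    (h : BRel.Iso Γ Δ) (n : ℕ) : BRel.Iso (F^[n] Γ) (F^[n] Δ) := by
  induction n with
  | zero => exact h
  | succ n ih =>
    rw [Function.iterate_succ_apply', Function.iterate_succ_apply']
    exact hF ih

theorem BRel.Cr_iterate_Cl_iso (Γ : BRel) (m : ℕ) :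
    BRel.Iso (BRel.Cr (BRel.Cl^[m] Γ)) (BRel.Cl^[m] (BRel.Cr Γ)) := by
  induction m with
  | zero => exact BRel.Iso.refl _
  | succ m ih =>
    rw [Function.iterate_succ_apply', Function.iterate_succ_apply']
    exact (BRel.Cr_Cl_iso _).trans ih.Cl

theorem BRel.Cr_contract_iso (Γ : BRel) (m n : ℕ) :
    BRel.Iso (BRel.Cr (BRel.Cl^[m] (BRel.Cr^[n] Γ))) (BRel.Cl^[m] (BRel.Cr^[n + 1] Γ)) := by
  rw [Function.iterate_succ_apply']
  exact BRel.Cr_iterate_Cl_iso _ m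

theorem BRel.Cl_contract (Γ : BRel) (m n : ℕ) :
    BRel.Cl (BRel.Cl^[m] (BRel.Cr^[n] Γ)) = BRel.Cl^[m + 1] (BRel.Cr^[n] Γ) :=
  (Function.iterate_succ_apply' _ _ _).symm

theorem BRel.Iso.Cl_of_injective {Γ : BRel} (h : Function.Injective (Quot.mk Γ.lgen)) :
    BRel.Iso Γ Γ.Cl := by
  refine ⟨Equiv.ofBijective (Quot.mk Γ.lgen) ⟨h, Quot.mk_surjective⟩, fun a b => ?_⟩
  constructor
  · rintro ⟨x, y, hx, hy, hR⟩
    rw [← h hx, ← h hy]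
    exact hR
  · intro hR
    exact ⟨a, b, rfl, rfl, hR⟩

theorem BRel.Iso.Cr_of_injective {Γ : BRel} (h : Function.Injective (Quot.mk Γ.rgen)) :
    BRel.Iso Γ Γ.Cr :=
  (BRel.Iso.Cl_of_injective (Γ := Γ.op) h).op.trans Γ.Cr_iso_op.symm

theorem injective_quotMk_of_card_le {α : Type} [Finite α] {r : α → α → Prop}
    (h : Nat.card α ≤ Nat.card (Quot r)) : Function.Injective (Quot.mk r) := by
  have := Fintype.ofFinite α
  have := Fintype.ofFinite (Quot r)
  refine (Function.Surjective.bijective_of_nat_card_le Quot.mk_surjective h).1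

/-- Iterating an operation which either preserves a relation or decreases its number of vertices
eventually stabilizes. -/
theorem BRel.exists_iterate_iso {F : BRel → BRel}
    (hF : ∀ {Γ Δ : BRel}, BRel.Iso Γ Δ → BRel.Iso (F Γ) (F Δ))
    (hF' : ∀ Γ, BRel.Iso Γ (F Γ) ∨ Nat.card (F Γ).S < Nat.card Γ.S) (Γ : BRel) :
    ∃ N, ∀ n, N ≤ n → BRel.Iso (F^[n] Γ) (F^[N] Γ) := by
  induction hc : Nat.card Γ.S using Nat.strong_induction_on generalizing Γ with
  | _ c ih =>
    subst hc
    rcases hF' Γ with h | h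
    · refine ⟨0, fun n _ => ?_⟩
      induction n with
      | zero => exact BRel.Iso.refl _
      | succ n ihn =>
        rw [Function.iterate_succ_apply]
        exact (BRel.Iso.iterate hF h.symm n).trans (ihn (Nat.zero_le _))
    · obtain ⟨N, hN⟩ := ih _ h (F Γ) rfl
      refine ⟨N + 1, fun n hn => ?_⟩
      obtain ⟨n, rfl⟩ : ∃ k, n = k + 1 := ⟨n - 1, by omega⟩
      rw [Function.iterate_succ_apply, Function.iterate_succ_apply]
      exact hN n (by omega)

theorem BRel.Cl_iso_or_card_lt (Γ : BRel) :
    BRel.Iso Γ Γ.Cl ∨ Nat.card Γ.Cl.S < Nat.card Γ.S := by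
  rcases lt_or_ge (Nat.card Γ.Cl.S) (Nat.card Γ.S) with h | h
  · exact Or.inr h
  · exact Or.inl (BRel.Iso.Cl_of_injective (injective_quotMk_of_card_le h))

theorem BRel.Cr_iso_or_card_lt (Γ : BRel) :
    BRel.Iso Γ Γ.Cr ∨ Nat.card Γ.Cr.S < Nat.card Γ.S := by
  rcases lt_or_ge (Nat.card Γ.Cr.S) (Nat.card Γ.S) with h | h
  · exact Or.inr h
  · exact Or.inl (BRel.Iso.Cr_of_injective (injective_quotMk_of_card_le h))

theorem BRel.exists_stabAt (Γ : BRel) : ∃ N, Γ.StabAt N := by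
  obtain ⟨n₀, h₀⟩ := BRel.exists_iterate_iso BRel.Iso.Cr BRel.Cr_iso_or_card_lt Γ
  obtain ⟨m₀, h₁⟩ := BRel.exists_iterate_iso BRel.Iso.Cl BRel.Cl_iso_or_card_lt
    (BRel.Cr^[n₀] Γ)
  have key : ∀ m n, m₀ ≤ m → n₀ ≤ n →
      BRel.Iso (BRel.Cl^[m] (BRel.Cr^[n] Γ)) (BRel.Cl^[m₀] (BRel.Cr^[n₀] Γ)) := fun m n hm hn =>
    (BRel.Iso.iterate BRel.Iso.Cl (h₀ n hn) m).trans (h₁ m hm)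
  refine ⟨max m₀ n₀, fun m hm n hn => ?_⟩
  exact (key m n (by omega) (by omega)).trans (key _ _ (by omega) (by omega)).symm

/-- A binary relation which is the graph of a partial injection. -/
def BRel.PartialInj (Γ : BRel) : Prop :=
  (∀ x y y', Γ.R x y → Γ.R x y' → y = y') ∧ (∀ x x' y, Γ.R x y → Γ.R x' y → x = x')

theorem BRel.StabAt.partialInj {Γ : BRel} {N : ℕ} (h : Γ.StabAt N) :
    (BRel.Cl^[N] (BRel.Cr^[N] Γ)).PartialInj := by
  have h1 : Nat.card (BRel.Cl^[N] (BRel.Cr^[N] Γ)).Cl.S =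
      Nat.card (BRel.Cl^[N] (BRel.Cr^[N] Γ)).S := by
    rw [BRel.Cl_contract]
    exact (h (N + 1) (Nat.le_succ N) N le_rfl).card_eq
  have h2 : Nat.card (BRel.Cl^[N] (BRel.Cr^[N] Γ)).Cr.S =
      Nat.card (BRel.Cl^[N] (BRel.Cr^[N] Γ)).S :=
    ((BRel.Cr_contract_iso Γ N N).trans (h N le_rfl (N + 1) (Nat.le_succ N))).card_eq
  exact ⟨fun x y y' hy hy' => injective_quotMk_of_card_le h1.ge (Quot.sound ⟨x, hy, hy'⟩),
    fun x x' y hx hx' => injective_quotMk_of_card_le h2.ge (Quot.sound ⟨y, hx, hx'⟩)⟩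

theorem BRel.StabAt.iso {Γ : BRel} {N k : ℕ} (h : Γ.StabAt N) (hk : N ≤ k) :
    BRel.Iso (BRel.Cl^[k] (BRel.Cr^[k] Γ)) (BRel.Cl^[N] (BRel.Cr^[N] Γ)) := h k hk k hk

end Relations
section Linearization

/-- The linear relation spanned by a binary relation. -/
noncomputable def BRel.lrel (Γ : BRel) : Submodule K ((Γ.S →₀ K) × (Γ.S →₀ K)) :=
  Submodule.span K {p | ∃ a b, Γ.R a b ∧ p = (Finsupp.single a 1, Finsupp.single b 1)}

/-- Isomorphism of the linear relations spanned by two binary relations. -/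
def BRel.LIso (Γ Δ : BRel) : Prop :=
  ∃ β : (Γ.S →₀ K) ≃ₗ[K] (Δ.S →₀ K), ∀ x y, (β x, β y) ∈ Δ.lrel K ↔ (x, y) ∈ Γ.lrel K

variable {K}

theorem BRel.single_mem_lrel {Γ : BRel} {a b : Γ.S} (h : Γ.R a b) :
    ((Finsupp.single a 1, Finsupp.single b 1) : (Γ.S →₀ K) × (Γ.S →₀ K)) ∈ Γ.lrel K :=
  Submodule.subset_span ⟨a, b, h, rfl⟩

theorem BRel.LIso.symm {Γ Δ : BRel} (h : BRel.LIso K Γ Δ) : BRel.LIso K Δ Γ := by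
  obtain ⟨β, hβ⟩ := h
  exact ⟨β.symm, fun x y => by rw [← hβ]; simp⟩

theorem BRel.LIso.trans {Γ Δ Θ : BRel} (h : BRel.LIso K Γ Δ) (h' : BRel.LIso K Δ Θ) :
    BRel.LIso K Γ Θ := by
  obtain ⟨φ, hφ⟩ := h
  obtain ⟨ψ, hψ⟩ := h'
  exact ⟨φ.trans ψ, fun a b => by simp [hφ, hψ]⟩

theorem BRel.LIso.card_eq {Γ Δ : BRel} (h : BRel.LIso K Γ Δ) :
    Nat.card Γ.S = Nat.card Δ.S := by
  obtain ⟨β, -⟩ := h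
  have := Fintype.ofFinite Γ.S
  have := Fintype.ofFinite Δ.S
  have := β.finrank_eq
  simpa using this

theorem BRel.map_lrel_le {Γ Δ : BRel} (f : Γ.S → Δ.S) (hf : ∀ a b, Γ.R a b → Δ.R (f a) (f b)) :
    (Γ.lrel K).map ((Finsupp.lmapDomain K K f).prodMap (Finsupp.lmapDomain K K f)) ≤
      Δ.lrel K := by
  rw [BRel.lrel, Submodule.map_span, Submodule.span_le]
  rintro _ ⟨_, ⟨a, b, hab, rfl⟩, rfl⟩
  simpa using BRel.single_mem_lrel (K := K) (hf a b hab)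

theorem BRel.Iso.lIso {Γ Δ : BRel} (h : BRel.Iso Γ Δ) : BRel.LIso K Γ Δ := by
  obtain ⟨φ, hφ⟩ := h
  refine ⟨Finsupp.domLCongr φ, fun x y => ⟨fun hxy => ?_, fun hxy => ?_⟩⟩
  · have := BRel.map_lrel_le (K := K) (Γ := Δ) (Δ := Γ) φ.symm
      (fun a b hab => by rw [← hφ]; simpa using hab) ⟨_, hxy, rfl⟩
    simpa [Finsupp.equivMapDomain_eq_mapDomain, ← Finsupp.mapDomain_comp,
      Finsupp.mapDomain_id] using this
  · have := BRel.map_lrel_le (K := K) (Γ := Γ) (Δ := Δ) φ (fun a b => (hφ a b).2)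
      ⟨_, hxy, rfl⟩
    simpa [Finsupp.equivMapDomain_eq_mapDomain] using this

theorem BRel.mem_lrel_op {Γ : BRel} (x y : Γ.S →₀ K) :
    (x, y) ∈ Γ.op.lrel K ↔ (y, x) ∈ Γ.lrel K := by
  have h : ∀ (Δ : BRel) (x y : Δ.S →₀ K), (x, y) ∈ Δ.lrel K → (y, x) ∈ Δ.op.lrel K := by
    intro Δ x y h
    have : Δ.lrel K ≤ (Δ.op.lrel K).comap (LinearEquiv.prodComm K _ _).toLinearMap := by
      refine Submodule.span_le.2 ?_
      rintro _ ⟨a, b, hab, rfl⟩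
      exact Submodule.subset_span ⟨b, a, hab, rfl⟩
    exact this h
  exact ⟨h Γ.op x y, h Γ y x⟩

theorem BRel.LIso.op {Γ Δ : BRel} (h : BRel.LIso K Γ Δ) : BRel.LIso K Γ.op Δ.op := by
  obtain ⟨β, hβ⟩ := h
  exact ⟨β, fun x y => (BRel.mem_lrel_op (Γ := Δ) (β x) (β y)).trans
    ((hβ y x).trans (BRel.mem_lrel_op (Γ := Γ) x y).symm)⟩

theorem ker_lmapDomain_quotMk {S : Type} (r : S → S → Prop) :
    LinearMap.ker (Finsupp.lmapDomain K K (Quot.mk r)) =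
      Submodule.span K {v | ∃ a b, r a b ∧ v = Finsupp.single a 1 - Finsupp.single b 1} := by
  apply le_antisymm
  · set W := Submodule.span K
      {v : S →₀ K | ∃ a b, r a b ∧ v = Finsupp.single a 1 - Finsupp.single b 1} with hW
    have h1 : ∀ a b, Relation.EqvGen r a b →
        (Finsupp.single a 1 - Finsupp.single b 1 : S →₀ K) ∈ W := by
      intro a b h
      induction h with
      | rel a b h => exact Submodule.subset_span ⟨a, b, h, rfl⟩
      | refl a => simp
      | symm a b _ ih =>
        rw [← neg_sub]
        exact W.neg_mem ih
      | trans a b c _ _ ih ih' =>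
        have := W.add_mem ih ih'
        simpa using this
    have h2 : ∀ v : S →₀ K, v - Finsupp.lmapDomain K K Quot.out
        (Finsupp.lmapDomain K K (Quot.mk r) v) ∈ W := by
      intro v
      induction v using Finsupp.induction_linear with
      | zero => simp
      | add f g hf hg =>
        have := W.add_mem hf hg
        rw [map_add, map_add]
        convert this using 1
        abel
      | single a c =>
        have := W.smul_mem c (h1 a _ (Quot.eqvGen_exact (Quot.out_eq (Quot.mk r a)).symm))
        simpa [smul_sub] using this
    intro v hv
    have := h2 v
    rw [LinearMap.mem_ker.1 hv] at this
    simpa using this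
  · rw [Submodule.span_le]
    rintro _ ⟨a, b, hab, rfl⟩
    have : Quot.mk r a = Quot.mk r b := Quot.sound hab
    rw [SetLike.mem_coe, LinearMap.mem_ker, map_sub]
    simp [this]

theorem BRel.leftKer_lrel (Γ : BRel) :
    LinearMap.ker (Finsupp.lmapDomain K K (Quot.mk Γ.lgen)) = leftKer (Γ.lrel K) := by
  rw [ker_lmapDomain_quotMk]
  apply le_antisymm
  · rw [Submodule.span_le]
    rintro _ ⟨a, b, ⟨x, ha, hb⟩, rfl⟩
    have := (Γ.lrel K).sub_mem (BRel.single_mem_lrel ha) (BRel.single_mem_lrel hb)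
    simpa [leftKer] using this
  · set W := Submodule.span K
      {v : Γ.S →₀ K | ∃ a b, Γ.lgen a b ∧ v = Finsupp.single a 1 - Finsupp.single b 1}
    classical
    let s : Γ.S → Γ.S := fun x => if h : ∃ y, Γ.R x y then h.choose else x
    let L : (Γ.S →₀ K) × (Γ.S →₀ K) →ₗ[K] (Γ.S →₀ K) :=
      LinearMap.snd K _ _ - Finsupp.lmapDomain K K s ∘ₗ LinearMap.fst K _ _
    have hle : Γ.lrel K ≤ W.comap L := by
      rw [BRel.lrel, Submodule.span_le]
      rintro _ ⟨a, b, hab, rfl⟩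
      have hs : Γ.R a (s a) := by
        have h : ∃ y, Γ.R a y := ⟨b, hab⟩
        simp only [s, dif_pos h]
        exact h.choose_spec
      refine Submodule.subset_span ⟨b, s a, ⟨a, hab, hs⟩, ?_⟩
      simp [L]
    intro y hy
    have := hle hy
    simpa [L] using this

theorem BRel.rightKer_lrel (Γ : BRel) :
    LinearMap.ker (Finsupp.lmapDomain K K (Quot.mk Γ.rgen)) = rightKer (Γ.lrel K) := by
  have h := BRel.leftKer_lrel (K := K) Γ.op
  ext x
  rw [mem_rightKer, ← BRel.mem_lrel_op]
  exact (Submodule.ext_iff.1 h) x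

theorem BRel.lrel_Cl (Γ : BRel) :
    (Γ.lrel K).map ((Finsupp.lmapDomain K K (Quot.mk Γ.lgen)).prodMap
      (Finsupp.lmapDomain K K (Quot.mk Γ.lgen))) = Γ.Cl.lrel K := by
  apply le_antisymm
  · exact BRel.map_lrel_le (Δ := Γ.Cl) _ fun a b hab => ⟨a, b, rfl, rfl, hab⟩
  · rw [BRel.lrel, BRel.lrel, Submodule.map_span]
    apply Submodule.span_mono
    rintro _ ⟨_, _, ⟨a, b, rfl, rfl, hab⟩, rfl⟩
    exact ⟨_, ⟨a, b, hab, rfl⟩, by simp; rfl⟩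

theorem lmapDomain_quotMk_surjective {S : Type} (r : S → S → Prop) :
    Function.Surjective (Finsupp.lmapDomain K K (Quot.mk r)) :=
  Finsupp.mapDomain_surjective Quot.mk_surjective

theorem finrank_rightKer_lrel (Γ : BRel) :
    Nat.card Γ.Cr.S + Module.finrank K (rightKer (Γ.lrel K)) = Nat.card Γ.S := by
  have := Fintype.ofFinite Γ.S
  have := Fintype.ofFinite (Quot Γ.rgen)
  have h := LinearMap.finrank_range_add_finrank_ker (Finsupp.lmapDomain K K (Quot.mk Γ.rgen))
  rw [LinearMap.range_eq_top.2 (lmapDomain_quotMk_surjective _), finrank_top,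
    BRel.rightKer_lrel, Module.finrank_finsupp_self, Module.finrank_finsupp_self] at h
  rw [Nat.card_eq_fintype_card (α := Γ.S), ← h]
  exact congrArg (· + _) (Nat.card_eq_fintype_card (α := Quot Γ.rgen))

/-- An isomorphism of the linear relations of left contractions lifts as soon as the numbers of
vertices of the relations and of their right contractions agree. -/
theorem BRel.LIso.of_Cl {Γ Δ : BRel} (h : BRel.LIso K Γ.Cl Δ.Cl)
    (hS : Nat.card Γ.S = Nat.card Δ.S) (hr : Nat.card Γ.Cr.S = Nat.card Δ.Cr.S) :
    BRel.LIso K Γ Δ := by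
  obtain ⟨φ, hφ⟩ := h
  have h1 := finrank_rightKer_lrel (K := K) Γ
  have h2 := finrank_rightKer_lrel (K := K) Δ
  refine exists_linearEquiv_of_contraction (Finsupp.lmapDomain K K (Quot.mk Γ.lgen))
    (Finsupp.lmapDomain K K (Quot.mk Δ.lgen)) (lmapDomain_quotMk_surjective _)
    (lmapDomain_quotMk_surjective _) _ _ (BRel.leftKer_lrel Γ) (BRel.leftKer_lrel Δ) φ
    ?_ ?_ (by omega)
  · rw [BRel.lrel_Cl, BRel.lrel_Cl]
    exact hφ
  · have := Fintype.ofFinite Γ.S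
    have := Fintype.ofFinite Δ.S
    simpa using hS

theorem BRel.LIso.of_Cr {Γ Δ : BRel} (h : BRel.LIso K Γ.Cr Δ.Cr)
    (hS : Nat.card Γ.S = Nat.card Δ.S) (hl : Nat.card Γ.Cl.S = Nat.card Δ.Cl.S) :
    BRel.LIso K Γ Δ := by
  have h' : BRel.LIso K Γ.op.Cl Δ.op.Cl :=
    ((Γ.Cr_iso_op.lIso.symm.trans h).trans Δ.Cr_iso_op.lIso).op
  exact (h'.of_Cl (Γ := Γ.op) (Δ := Δ.op) hS
    (Γ.op.Cr_iso_op.card_eq.trans (hl.trans Δ.op.Cr_iso_op.card_eq.symm))).op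

theorem BRel.LIso.Cl {Γ Δ : BRel} (h : BRel.LIso K Γ Δ) : BRel.LIso K Γ.Cl Δ.Cl := by
  obtain ⟨β, hβ⟩ := h
  obtain ⟨φ, hφ⟩ := exists_linearEquiv_descend (Finsupp.lmapDomain K K (Quot.mk Γ.lgen))
    (Finsupp.lmapDomain K K (Quot.mk Δ.lgen)) (lmapDomain_quotMk_surjective _)
    (lmapDomain_quotMk_surjective _) β (by
      intro x
      rw [← LinearMap.mem_ker, ← LinearMap.mem_ker, BRel.leftKer_lrel, BRel.leftKer_lrel,
        mem_leftKer, mem_leftKer, ← hβ, map_zero])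
  refine ⟨φ, fun x y => ?_⟩
  rw [← BRel.lrel_Cl, ← BRel.lrel_Cl]
  constructor
  · rintro ⟨⟨a, b⟩, hab, h⟩
    obtain ⟨a, rfl⟩ := β.surjective a
    obtain ⟨b, rfl⟩ := β.surjective b
    refine ⟨(a, b), (hβ a b).1 hab, ?_⟩
    have e1 := congrArg Prod.fst h
    have e2 := congrArg Prod.snd h
    exact Prod.ext (φ.injective ((hφ a).trans e1)) (φ.injective ((hφ b).trans e2))
  · rintro ⟨⟨a, b⟩, hab, h⟩
    refine ⟨(β a, β b), (hβ a b).2 hab, ?_⟩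
    have e1 := congrArg Prod.fst h
    have e2 := congrArg Prod.snd h
    exact Prod.ext ((hφ a).symm.trans (congrArg φ e1)) ((hφ b).symm.trans (congrArg φ e2))

theorem BRel.LIso.Cr {Γ Δ : BRel} (h : BRel.LIso K Γ Δ) : BRel.LIso K Γ.Cr Δ.Cr :=
  (Γ.Cr_iso_op.lIso.trans h.op.Cl.op).trans Δ.Cr_iso_op.symm.lIso

theorem BRel.LIso.iterate {F : BRel → BRel}
    (hF : ∀ {Γ Δ : BRel}, BRel.LIso K Γ Δ → BRel.LIso K (F Γ) (F Δ)) {Γ Δ : BRel}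
    (h : BRel.LIso K Γ Δ) (n : ℕ) : BRel.LIso K (F^[n] Γ) (F^[n] Δ) := by
  induction n with
  | zero => exact h
  | succ n ih =>
    rw [Function.iterate_succ_apply', Function.iterate_succ_apply']
    exact hF ih

theorem BRel.LIso.contract {Γ Δ : BRel} (h : BRel.LIso K Γ Δ) (m n : ℕ) :
    BRel.LIso K (BRel.Cl^[m] (BRel.Cr^[n] Γ)) (BRel.Cl^[m] (BRel.Cr^[n] Δ)) :=
  BRel.LIso.iterate BRel.LIso.Cl (BRel.LIso.iterate BRel.LIso.Cr h n) m

theorem BRel.card_Cr_contract (Γ : BRel) (m n : ℕ) :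
    Nat.card (BRel.Cr (BRel.Cl^[m] (BRel.Cr^[n] Γ))).S = Γ.gamma m (n + 1) :=
  (BRel.Cr_contract_iso Γ m n).card_eq

theorem BRel.card_Cl_contract (Γ : BRel) (m n : ℕ) :
    Nat.card (BRel.Cl (BRel.Cl^[m] (BRel.Cr^[n] Γ))).S = Γ.gamma (m + 1) n := by
  rw [BRel.Cl_contract]
  rfl

/-- If sufficiently many vertex counts agree, then an isomorphism of linear relations lifts from
deep contractions. -/
theorem BRel.LIso.of_contract {Γ Δ : BRel}
    (hγ : ∀ i j : ℕ, |(i : ℤ) - (j : ℤ)| ≤ 2 → Γ.gamma i j = Δ.gamma i j) (k : ℕ)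
    (h : BRel.LIso K (BRel.Cl^[k] (BRel.Cr^[k] Γ)) (BRel.Cl^[k] (BRel.Cr^[k] Δ))) :
    BRel.LIso K Γ Δ := by
  induction k with
  | zero => exact h
  | succ k ih =>
    have h1 : BRel.LIso K (BRel.Cl^[k + 1] (BRel.Cr^[k] Γ))
        (BRel.Cl^[k + 1] (BRel.Cr^[k] Δ)) := by
      refine BRel.LIso.of_Cr (((BRel.Cr_contract_iso Γ _ _).lIso.trans h).trans
        (BRel.Cr_contract_iso Δ _ _).symm.lIso) ?_ ?_
      · exact hγ (k + 1) k (by push_cast; rw [abs_le]; constructor <;> linarith)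
      · rw [BRel.card_Cl_contract, BRel.card_Cl_contract]
        exact hγ _ _ (by push_cast; rw [abs_le]; constructor <;> linarith)
    refine ih (BRel.LIso.of_Cl ?_ ?_ ?_)
    · rw [BRel.Cl_contract, BRel.Cl_contract]
      exact h1
    · exact hγ k k (by simp)
    · rw [BRel.card_Cr_contract, BRel.card_Cr_contract]
      exact hγ _ _ (by push_cast; rw [abs_le]; constructor <;> linarith)

/-- Isomorphism of transformation-pairs in terms of the image in `V × V`. -/
theorem Pair.iso_iff (τ σ : Pair K) : Pair.Iso K τ σ ↔
    Module.finrank K τ.E = Module.finrank K σ.E ∧ ∃ β : τ.V ≃ₗ[K] σ.V, ∀ x y,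
      (∃ e, σ.mu e = β x ∧ σ.nu e = β y) ↔ ∃ e, τ.mu e = x ∧ τ.nu e = y := by
  constructor
  · rintro ⟨α, β, h1, h2⟩
    refine ⟨α.finrank_eq, β, fun x y => ⟨?_, ?_⟩⟩
    · rintro ⟨e, he, he'⟩
      obtain ⟨e, rfl⟩ := α.surjective e
      rw [h1] at he
      rw [h2] at he'
      exact ⟨e, β.injective he, β.injective he'⟩
    · rintro ⟨e, rfl, rfl⟩
      exact ⟨α e, h1 e, h2 e⟩
  · rintro ⟨hE, β, h⟩
    have hmem : ∀ e, ((β.toLinearMap.prodMap β.toLinearMap) ∘ₗ τ.mu.prod τ.nu) e ∈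
        LinearMap.range (σ.mu.prod σ.nu) := by
      intro e
      obtain ⟨e', h1, h2⟩ := (h _ _).2 ⟨e, rfl, rfl⟩
      exact ⟨e', Prod.ext h1 h2⟩
    obtain ⟨α, hα⟩ := exists_linearEquiv_lift (LinearMap.codRestrict _ _ hmem)
      (σ.mu.prod σ.nu).rangeRestrict (by
        rintro ⟨_, e', rfl⟩
        obtain ⟨e, h1, h2⟩ := (h (β.symm (σ.mu e')) (β.symm (σ.nu e'))).1 ⟨e', by simp⟩
        refine ⟨e, Subtype.ext (Prod.ext ?_ ?_)⟩
        · change β (τ.mu e) = σ.mu e'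
          simp [h1]
        · change β (τ.nu e) = σ.nu e'
          simp [h2]) (LinearMap.surjective_rangeRestrict _) hE
    exact ⟨α, β, fun x => congrArg (fun z => z.1.1) (hα x),
      fun x => congrArg (fun z => z.1.2) (hα x)⟩

/-- The target of the linearization in terms of finitely supported functions. -/
noncomputable def BRel.linzV (K : Type) [Field K] (Γ : BRel) : (Γ.S →₀ K) ≃ₗ[K] (Γ.linz K).V :=
  Finsupp.linearEquivFunOnFinite K K Γ.S

theorem toLin'_indicator {S E : Type} [Fintype E] [DecidableEq E] [DecidableEq S]
    (g : E → S) (e : E) (u : E → K) (hu : u e = 1) (hu' : ∀ e', e' ≠ e → u e' = 0) :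
    Matrix.toLin' (Matrix.of fun (v : S) (e : E) => if g e = v then (1 : K) else 0) u =
      Finsupp.single (g e) (1 : K) := by
  obtain rfl : u = Pi.single e 1 := by
    funext e'
    by_cases h : e' = e
    · subst h
      simp [hu]
    · simp [hu' e' h, h]
  funext v
  simp [Finsupp.single_apply, Matrix.mulVec_single]

theorem BRel.linz_mu_nu_single (Γ : BRel) [DecidableEq {p : Γ.S × Γ.S // Γ.R p.1 p.2}]
    (e : {p : Γ.S × Γ.S // Γ.R p.1 p.2}) :
    (Γ.linz K).mu (Pi.single e (1 : K) : {p : Γ.S × Γ.S // Γ.R p.1 p.2} → K) =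
        Γ.linzV K (Finsupp.single e.1.1 1) ∧
      (Γ.linz K).nu (Pi.single e (1 : K) : {p : Γ.S × Γ.S // Γ.R p.1 p.2} → K) =
        Γ.linzV K (Finsupp.single e.1.2 1) := by
  have h1 := Pi.single_eq_same (M := fun _ : {p : Γ.S × Γ.S // Γ.R p.1 p.2} => K) e 1
  have h2 : ∀ e' : {p : Γ.S × Γ.S // Γ.R p.1 p.2}, e' ≠ e →
      (Pi.single e (1 : K) : {p : Γ.S × Γ.S // Γ.R p.1 p.2} → K) e' = 0 := fun e' h =>
    Pi.single_eq_of_ne h _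
  let := Fintype.ofFinite Γ.S
  let := Classical.decEq Γ.S
  let : DecidablePred (fun p : Γ.S × Γ.S => Γ.R p.1 p.2) := Classical.decPred _
  exact ⟨toLin'_indicator (fun e : {p : Γ.S × Γ.S // Γ.R p.1 p.2} => e.1.1) e _ h1 h2,
    toLin'_indicator (fun e : {p : Γ.S × Γ.S // Γ.R p.1 p.2} => e.1.2) e _ h1 h2⟩

theorem BRel.map_lrel_linzV (Γ : BRel) :
    (Γ.lrel K).map ((Γ.linzV K).toLinearMap.prodMap (Γ.linzV K).toLinearMap) =
      LinearMap.range ((Γ.linz K).mu.prod (Γ.linz K).nu) := by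
  classical
  have hsingle : ∀ e : {p : Γ.S × Γ.S // Γ.R p.1 p.2},
      ((Γ.linz K).mu.prod (Γ.linz K).nu)
          (Pi.single e (1 : K) : {p : Γ.S × Γ.S // Γ.R p.1 p.2} → K) =
        ((Γ.linzV K).toLinearMap.prodMap (Γ.linzV K).toLinearMap)
          (Finsupp.single e.1.1 1, Finsupp.single e.1.2 1) := fun e =>
    Prod.ext (Γ.linz_mu_nu_single e).1 (Γ.linz_mu_nu_single e).2
  apply le_antisymm
  · rw [BRel.lrel, Submodule.map_span, Submodule.span_le]
    rintro _ ⟨_, ⟨a, b, hab, rfl⟩, rfl⟩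
    exact ⟨_, hsingle ⟨(a, b), hab⟩⟩
  · have := Fintype.ofFinite {p : Γ.S × Γ.S // Γ.R p.1 p.2}
    rw [LinearMap.range_le_iff_comap, eq_top_iff]
    have hb := (Pi.basisFun K {p : Γ.S × Γ.S // Γ.R p.1 p.2}).span_eq
    refine hb.ge.trans (Submodule.span_le.2 ?_)
    rintro _ ⟨e, rfl⟩
    rw [Pi.basisFun_apply]
    exact ⟨_, BRel.single_mem_lrel e.2, (hsingle e).symm⟩

theorem BRel.mem_lrel_iff (Γ : BRel) (x y : Γ.S →₀ K) : (x, y) ∈ Γ.lrel K ↔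
    ∃ e : (Γ.linz K).E, (Γ.linz K).mu e = Γ.linzV K x ∧ (Γ.linz K).nu e = Γ.linzV K y := by
  constructor
  · intro h
    have : ((Γ.linzV K).toLinearMap.prodMap (Γ.linzV K).toLinearMap) (x, y) ∈
      (Γ.lrel K).map ((Γ.linzV K).toLinearMap.prodMap (Γ.linzV K).toLinearMap) := ⟨_, h, rfl⟩
    rw [BRel.map_lrel_linzV] at this
    obtain ⟨e, he⟩ := this
    exact ⟨e, congrArg Prod.fst he, congrArg Prod.snd he⟩
  · rintro ⟨e, h1, h2⟩
    have : ((Γ.linzV K).toLinearMap.prodMap (Γ.linzV K).toLinearMap) (x, y) ∈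
        (Γ.lrel K).map ((Γ.linzV K).toLinearMap.prodMap (Γ.linzV K).toLinearMap) := by
      rw [BRel.map_lrel_linzV]
      exact ⟨e, Prod.ext h1 h2⟩
    obtain ⟨z, hz, hzf⟩ := this
    have : z = (x, y) := Prod.ext ((Γ.linzV K).injective (congrArg Prod.fst hzf))
      ((Γ.linzV K).injective (congrArg Prod.snd hzf))
    exact this ▸ hz

theorem BRel.finrank_linz_E (Γ : BRel) : Module.finrank K (Γ.linz K).E = Γ.edges := by
  classical
  have := Fintype.ofFinite {p : Γ.S × Γ.S // Γ.R p.1 p.2}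
  change Module.finrank K ({p : Γ.S × Γ.S // Γ.R p.1 p.2} → K) = _
  rw [Module.finrank_fintype_fun_eq_card, BRel.edges, Nat.card_eq_fintype_card]

theorem BRel.linz_iso_iff (Γ Δ : BRel) : Pair.Iso K (Γ.linz K) (Δ.linz K) ↔
    BRel.LIso K Γ Δ ∧ Γ.edges = Δ.edges := by
  rw [Pair.iso_iff, BRel.finrank_linz_E, BRel.finrank_linz_E, and_comm]
  refine and_congr_left' ⟨?_, ?_⟩
  · rintro ⟨β, hβ⟩
    refine ⟨Γ.linzV K ≪≫ₗ β ≪≫ₗ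
      (Δ.linzV K).symm, fun x y => ?_⟩
    rw [BRel.mem_lrel_iff, BRel.mem_lrel_iff, ← hβ]
    simp only [LinearEquiv.trans_apply, LinearEquiv.apply_symm_apply]
  · rintro ⟨β, hβ⟩
    refine ⟨(Γ.linzV K).symm ≪≫ₗ β ≪≫ₗ
      Δ.linzV K, fun x y => ?_⟩
    have := hβ ((Γ.linzV K).symm x)
      ((Γ.linzV K).symm y)
    rw [BRel.mem_lrel_iff, BRel.mem_lrel_iff] at this
    simpa only [LinearEquiv.trans_apply, LinearEquiv.apply_symm_apply] using this

end Linearization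
section Permutations

/-- Counting points whose cycle has a given length `n ≥ 2`. -/
theorem card_orderOf_cycleOf {S : Type} [Fintype S] [DecidableEq S] (f : Equiv.Perm S) {n : ℕ}
    (hn : 2 ≤ n) : (Finset.univ.filter fun x => orderOf (f.cycleOf x) = n).card =
      n * f.cycleType.count n := by
  have h : (Finset.univ.filter fun x => orderOf (f.cycleOf x) = n) =
      (f.cycleFactorsFinset.filter fun c => n = c.support.card).biUnion
        Equiv.Perm.support := by
    ext x
    simp only [Finset.mem_filter, Finset.mem_univ, true_and, Finset.mem_biUnion]
    constructor
    · intro hx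
      have hfx : f x ≠ x := by
        intro h
        rw [(Equiv.Perm.cycleOf_eq_one_iff f).2 h, orderOf_one] at hx
        omega
      have hc := f.isCycle_cycleOf hfx
      refine ⟨f.cycleOf x, ⟨Equiv.Perm.cycleOf_mem_cycleFactorsFinset_iff.2
        (Equiv.Perm.mem_support.2 hfx), ?_⟩, ?_⟩
      · rw [← hc.orderOf, hx]
      · exact Equiv.Perm.mem_support_cycleOf_iff.2
          ⟨Equiv.Perm.SameCycle.refl _ _, Equiv.Perm.mem_support.2 hfx⟩
    · rintro ⟨c, ⟨hc, hcard⟩, hx⟩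
      rw [← Equiv.Perm.cycle_is_cycleOf hx hc, hcard]
      exact (Equiv.Perm.mem_cycleFactorsFinset_iff.1 hc).1.orderOf
  rw [h, Finset.card_biUnion]
  · rw [Finset.sum_congr rfl fun c hc => (Finset.mem_filter.1 hc).2.symm, Finset.sum_const,
      smul_eq_mul, mul_comm, Equiv.Perm.cycleType_def, Multiset.count_map]
    rfl
  · intro c hc d hd hcd
    exact (f.cycleFactorsFinset_pairwise_disjoint (Finset.mem_filter.1 hc).1
      (Finset.mem_filter.1 hd).1 hcd).disjoint_support

theorem pow_apply_eq_self_iff {S : Type} [Fintype S] [DecidableEq S] (f : Equiv.Perm S) (k : ℕ)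
    (x : S) : (f ^ k) x = x ↔ orderOf (f.cycleOf x) ∣ k := by
  rw [orderOf_dvd_iff_pow_eq_one]
  by_cases hx : f x = x
  · rw [(Equiv.Perm.cycleOf_eq_one_iff f).2 hx, one_pow]
    exact iff_of_true (Equiv.Perm.pow_apply_eq_self_of_apply_eq_self hx k) rfl
  · rw [(f.isCycle_cycleOf hx).pow_eq_one_iff' (x := x) (by simpa using hx),
      Equiv.Perm.cycleOf_pow_apply_self]

/-- Permutations whose powers have the same numbers of fixed points are conjugate. -/
theorem isConj_of_card_fixed {S : Type} [Fintype S] [DecidableEq S] {f g : Equiv.Perm S}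
    (h : ∀ k, Nat.card {x // (f ^ k) x = x} = Nat.card {x // (g ^ k) x = x}) : IsConj f g := by
  have key : ∀ n, 0 < n → (Finset.univ.filter fun x => orderOf (f.cycleOf x) = n).card =
      (Finset.univ.filter fun x => orderOf (g.cycleOf x) = n).card := by
    have hsum : ∀ (u : Equiv.Perm S) (n : ℕ), 0 < n → Nat.card {x // (u ^ n) x = x} =
        ∑ d ∈ n.properDivisors, (Finset.univ.filter fun x => orderOf (u.cycleOf x) = d).card +
          (Finset.univ.filter fun x => orderOf (u.cycleOf x) = n).card := by
      intro u n hn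
      rw [Nat.card_eq_fintype_card, Fintype.card_subtype, add_comm,
        ← Finset.sum_insert (f := fun d =>
          (Finset.univ.filter fun x => orderOf (u.cycleOf x) = d).card)
          Nat.self_notMem_properDivisors, Nat.insert_self_properDivisors hn.ne',
        Finset.card_eq_sum_card_fiberwise (f := fun x => orderOf (u.cycleOf x))
          (t := n.divisors)]
      · refine Finset.sum_congr rfl fun d hd => ?_
        rw [Finset.filter_filter]
        congr 1
        ext x
        simp only [Finset.mem_filter, Finset.mem_univ, true_and, and_iff_right_iff_imp,
          pow_apply_eq_self_iff]
        rintro rfl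
        exact Nat.dvd_of_mem_divisors hd
      · intro x hx
        simp only [Finset.coe_filter, Finset.mem_univ, true_and, Set.mem_ofPred_eq,
          pow_apply_eq_self_iff] at hx
        exact Nat.mem_divisors.2 ⟨hx, hn.ne'⟩
    intro n
    induction n using Nat.strong_induction_on with
    | _ n ih =>
      intro hn
      have e := h n
      rw [hsum f n hn, hsum g n hn, Finset.sum_congr rfl fun d hd =>
        ih d (Nat.mem_properDivisors.1 hd).2 (Nat.pos_of_mem_properDivisors hd)] at e
      exact Nat.add_left_cancel e
  rw [Equiv.Perm.isConj_iff_cycleType_eq]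
  ext n
  rcases lt_or_ge n 2 with hn | hn
  · rw [Multiset.count_eq_zero_of_notMem, Multiset.count_eq_zero_of_notMem] <;>
    · intro hmem
      have := Equiv.Perm.two_le_of_mem_cycleType hmem
      omega
  · have e := key n (by omega)
    rw [card_orderOf_cycleOf f hn, card_orderOf_cycleOf g hn] at e
    exact Nat.eq_of_mul_eq_mul_left (by omega) e

/-- Burnside's formula for the cyclic group generated by a permutation. -/
theorem sum_card_fixed_pow {S : Type} [Finite S] (f : Equiv.Perm S) :
    ∑ j ∈ Finset.range (orderOf f), Nat.card {x // (f ^ j) x = x} =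
      Nat.card (Quot fun a b => a = f b) * orderOf f := by
  classical
  have := Fintype.ofFinite S
  have hinv : ∀ (i : ℤ) (b : S), Quot.mk (fun a b => a = f b) ((f ^ i) b) = Quot.mk _ b := by
    intro i
    induction i using Int.induction_on with
    | zero => simp
    | succ i ih =>
      intro b
      rw [zpow_add_one, Equiv.Perm.mul_apply, ih]
      exact Quot.sound rfl
    | pred i ih =>
      intro b
      rw [zpow_sub_one, Equiv.Perm.mul_apply, ih]
      exact (Quot.sound (by simp)).symm
  let e : (Quot fun a b => a = f b) ≃
      Quotient (MulAction.orbitRel (Subgroup.zpowers f) S) :=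
    { toFun := Quot.lift (fun a => Quotient.mk _ a) (by
        rintro _ b rfl
        exact Quotient.sound ⟨⟨f, Subgroup.mem_zpowers f⟩, rfl⟩)
      invFun := Quotient.lift (fun a => Quot.mk _ a) (by
        rintro a b ⟨⟨_, i, rfl⟩, rfl⟩
        exact hinv i b)
      left_inv := by
        rintro ⟨a⟩
        rfl
      right_inv := by
        rintro ⟨a⟩
        rfl }
  have := Fintype.ofFinite (Quotient (MulAction.orbitRel (Subgroup.zpowers f) S))
  have hB := MulAction.sum_card_fixedBy_eq_card_orbits_mul_card_group (Subgroup.zpowers f) S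
  rw [Fintype.card_zpowers, ← Nat.card_eq_fintype_card, ← Nat.card_congr e] at hB
  rw [← hB, Finset.sum_range, ← (finEquivZPowers (isOfFinOrder_of_finite f)).sum_comp]
  refine Finset.sum_congr rfl fun j _ => ?_
  rw [finEquivZPowers_apply, Nat.card_eq_fintype_card]
  exact Fintype.card_congr (Equiv.refl _)

/-- Similarity of the permutation matrices of two permutations. -/
def PermSimilar (K : Type) [Field K] {S : Type} (f g : Equiv.Perm S) : Prop :=
  ∃ β : (S →₀ K) ≃ₗ[K] (S →₀ K), ∀ x,
    β (Finsupp.lmapDomain K K f x) = Finsupp.lmapDomain K K g (β x)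

variable {K}

theorem PermSimilar.pow {S : Type} {f g : Equiv.Perm S} (h : PermSimilar K f g) (k : ℕ) :
    PermSimilar K (f ^ k) (g ^ k) := by
  obtain ⟨β, hβ⟩ := h
  refine ⟨β, fun x => ?_⟩
  induction k with
  | zero => simp
  | succ k ih =>
    rw [pow_succ', pow_succ', Equiv.Perm.coe_mul, Equiv.Perm.coe_mul, Finsupp.lmapDomain_comp,
      Finsupp.lmapDomain_comp, LinearMap.comp_apply, LinearMap.comp_apply, hβ, ih]

theorem lmapDomain_eq_id_iff {S : Type} (f : Equiv.Perm S) :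
    (∀ x, Finsupp.lmapDomain K K f x = x) ↔ f = 1 := by
  constructor
  · intro h
    ext a
    have := h (Finsupp.single a 1)
    rw [Finsupp.lmapDomain_apply, Finsupp.mapDomain_single] at this
    exact Finsupp.single_left_injective one_ne_zero this
  · rintro rfl x
    simp

theorem PermSimilar.orderOf_eq {S : Type} {f g : Equiv.Perm S} (h : PermSimilar K f g) :
    orderOf f = orderOf g := by
  rw [orderOf_eq_orderOf_iff]
  intro n
  obtain ⟨β, hβ⟩ := h.pow n
  rw [← lmapDomain_eq_id_iff (K := K), ← lmapDomain_eq_id_iff (K := K),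
    β.surjective.forall (p := fun y => Finsupp.lmapDomain K K (g ^ n) y = y)]
  refine forall_congr' fun x => ?_
  rw [← hβ, β.injective.eq_iff]

theorem mapDomain_quotMk_eq_zero_iff {S : Type} (f : Equiv.Perm S) (x : S →₀ K) :
    Finsupp.lmapDomain K K (Quot.mk fun a b => a = f b) x = 0 ↔
      ∃ y, Finsupp.lmapDomain K K f y - y = x := by
  rw [← LinearMap.mem_ker]
  have hr : LinearMap.ker (Finsupp.lmapDomain K K (Quot.mk fun a b => a = f b)) =
      LinearMap.range (Finsupp.lmapDomain K K f - LinearMap.id) := by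
    apply le_antisymm
    · rw [ker_lmapDomain_quotMk, Submodule.span_le]
      rintro _ ⟨_, b, rfl, rfl⟩
      exact ⟨Finsupp.single b 1, by simp⟩
    · rintro _ ⟨y, rfl⟩
      have : (Quot.mk fun a b => a = f b) ∘ f = Quot.mk fun a b => a = f b := by
        funext b
        exact Quot.sound rfl
      rw [LinearMap.mem_ker, LinearMap.sub_apply, map_sub, ← LinearMap.comp_apply,
        ← Finsupp.lmapDomain_comp, this]
      simp
  rw [hr]
  rfl

theorem PermSimilar.card_quot_eq {S : Type} [Finite S] {f g : Equiv.Perm S}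
    (h : PermSimilar K f g) :
    Nat.card (Quot fun a b => a = f b) = Nat.card (Quot fun a b => a = g b) := by
  obtain ⟨β, hβ⟩ := h
  obtain ⟨φ, -⟩ := exists_linearEquiv_descend
    (Finsupp.lmapDomain K K (Quot.mk fun a b => a = f b))
    (Finsupp.lmapDomain K K (Quot.mk fun a b => a = g b)) (lmapDomain_quotMk_surjective _)
    (lmapDomain_quotMk_surjective _) β (by
      intro x
      rw [mapDomain_quotMk_eq_zero_iff, mapDomain_quotMk_eq_zero_iff, β.surjective.exists]
      refine exists_congr fun y => ?_
      rw [← hβ, ← map_sub, β.injective.eq_iff])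
  have := Fintype.ofFinite (Quot fun a b => a = f b)
  have := Fintype.ofFinite (Quot fun a b => a = g b)
  simpa using φ.finrank_eq

theorem pow_apply_eq_self_iff_of_coprime {S : Type} (f : Equiv.Perm S) {j : ℕ}
    (hj : j.Coprime (orderOf f)) (x : S) : (f ^ j) x = x ↔ f x = x := by
  constructor
  · intro h
    obtain ⟨m, hm⟩ := exists_pow_eq_self_of_coprime hj
    have := Equiv.Perm.pow_apply_eq_self_of_apply_eq_self h m
    rwa [hm] at this
  · exact fun h => Equiv.Perm.pow_apply_eq_self_of_apply_eq_self h j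

theorem PermSimilar.card_fixed_eq {S : Type} [Finite S] {f g : Equiv.Perm S}
    (h : PermSimilar K f g) : Nat.card {x // f x = x} = Nat.card {x // g x = x} := by
  induction hn : orderOf f using Nat.strong_induction_on generalizing f g with
  | _ n ih =>
    have hg : orderOf g = n := h.orderOf_eq ▸ hn
    have hn0 : 0 < n := hn ▸ orderOf_pos f
    have e : ∑ j ∈ Finset.range n, Nat.card {x // (f ^ j) x = x} =
        ∑ j ∈ Finset.range n, Nat.card {x // (g ^ j) x = x} := by
      have e1 := sum_card_fixed_pow f
      have e2 := sum_card_fixed_pow g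
      rw [hn] at e1
      rw [hg] at e2
      rw [e1, e2, h.card_quot_eq]
    rw [← Finset.sum_filter_add_sum_filter_not _ (fun j => n.Coprime j),
      ← Finset.sum_filter_add_sum_filter_not _ (fun j => n.Coprime j)
        (fun j => Nat.card {x // (g ^ j) x = x})] at e
    have e3 : ∑ j ∈ Finset.range n with ¬ n.Coprime j, Nat.card {x // (f ^ j) x = x} =
        ∑ j ∈ Finset.range n with ¬ n.Coprime j, Nat.card {x // (g ^ j) x = x} := by
      refine Finset.sum_congr rfl fun j hj => ih _ ?_ (h.pow j) rfl
      rw [orderOf_pow, hn]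
      refine Nat.div_lt_self hn0 ?_
      have h0 : n.gcd j ≠ 1 := (Finset.mem_filter.1 hj).2
      have h1 : 0 < n.gcd j := Nat.gcd_pos_of_pos_left _ hn0
      omega
    have e4 : ∀ u : Equiv.Perm S, orderOf u = n →
        ∑ j ∈ Finset.range n with n.Coprime j, Nat.card {x // (u ^ j) x = x} =
          n.totient * Nat.card {x // u x = x} := by
      intro u hu
      rw [Nat.totient_eq_card_coprime, ← smul_eq_mul, ← Finset.sum_const]
      refine Finset.sum_congr rfl fun j hj => Nat.card_congr (Equiv.subtypeEquivRight fun x => ?_)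
      exact pow_apply_eq_self_iff_of_coprime u
        (hu ▸ (Nat.coprime_comm.1 (Finset.mem_filter.1 hj).2)) x
    rw [e3, e4 f hn, e4 g hg] at e
    exact Nat.eq_of_mul_eq_mul_left (Nat.totient_pos.2 hn0) (Nat.add_right_cancel e)

/-- Permutations with similar permutation matrices are conjugate. -/
theorem PermSimilar.isConj {S : Type} [Finite S] {f g : Equiv.Perm S} (h : PermSimilar K f g) :
    IsConj f g := by
  classical
  have := Fintype.ofFinite S
  exact isConj_of_card_fixed fun k => (h.pow k).card_fixed_eq

theorem exists_equiv_semiconj {S T : Type} [Finite S] [Finite T] (f : Equiv.Perm S)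
    (g : Equiv.Perm T) (β : (S →₀ K) ≃ₗ[K] (T →₀ K))
    (hβ : ∀ x, β (Finsupp.lmapDomain K K f x) = Finsupp.lmapDomain K K g (β x)) :
    ∃ φ : S ≃ T, ∀ a, φ (f a) = g (φ a) := by
  have := Fintype.ofFinite S
  have := Fintype.ofFinite T
  have hc : Fintype.card S = Fintype.card T := by simpa using β.finrank_eq
  let e := Fintype.equivOfCardEq hc
  have h : PermSimilar K f (e.symm.permCongr g) := by
    refine ⟨β ≪≫ₗ Finsupp.domLCongr e.symm, fun x => ?_⟩
    rw [LinearEquiv.trans_apply, hβ]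
    simp only [LinearEquiv.trans_apply, Finsupp.domLCongr_apply, Finsupp.domCongr_apply,
      Finsupp.equivMapDomain_eq_mapDomain, Finsupp.lmapDomain_apply, ← Finsupp.mapDomain_comp]
    congr 1
    funext a
    simp
  obtain ⟨c, hc⟩ := isConj_iff.1 h.isConj
  refine ⟨c.trans e, fun a => ?_⟩
  have := congrArg (fun u : Equiv.Perm S => e (u (c a))) hc
  simpa using this

end Permutations
section PartialInjections

variable {K}

theorem BRel.PartialInj.op {Γ : BRel} (h : Γ.PartialInj) : Γ.op.PartialInj :=
  ⟨fun x y y' hy hy' => h.2 y y' x hy hy', fun x x' y hx hx' => h.1 y x x' hx hx'⟩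

theorem BRel.PartialInj.eq_of_mem_lrel {Γ : BRel} (h : Γ.PartialInj) {x y y' : Γ.S →₀ K}
    (hy : (x, y) ∈ Γ.lrel K) (hy' : (x, y') ∈ Γ.lrel K) : y = y' := by
  have hinj : Function.Injective (Quot.mk Γ.lgen) := fun a b hab =>
    congrArg (Quot.lift id fun a b ⟨x, ha, hb⟩ => h.1 x a b ha hb) hab
  have hk : y - y' ∈ leftKer (Γ.lrel K) := by
    rw [mem_leftKer]
    simpa using (Γ.lrel K).sub_mem hy hy'
  rw [← BRel.leftKer_lrel, LinearMap.ker_eq_bot.2 (Finsupp.mapDomain_injective hinj),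
    Submodule.mem_bot] at hk
  exact sub_eq_zero.1 hk

theorem BRel.PartialInj.eq_of_mem_lrel' {Γ : BRel} (h : Γ.PartialInj) {x x' y : Γ.S →₀ K}
    (hx : (x, y) ∈ Γ.lrel K) (hx' : (x', y) ∈ Γ.lrel K) : x = x' :=
  h.op.eq_of_mem_lrel ((BRel.mem_lrel_op (Γ := Γ) y x).2 hx)
    ((BRel.mem_lrel_op (Γ := Γ) y x').2 hx')

/-- The restriction of a binary relation to the vertices which have a predecessor. -/
def BRel.restr (Γ : BRel) : BRel where
  S := {y : Γ.S // ∃ x, Γ.R x y}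
  R := fun a b => Γ.R a.1 b.1

theorem BRel.PartialInj.restr {Γ : BRel} (h : Γ.PartialInj) : Γ.restr.PartialInj :=
  ⟨fun _ _ _ hy hy' => Subtype.ext (h.1 _ _ _ hy hy'),
    fun _ _ _ hx hx' => Subtype.ext (h.2 _ _ _ hx hx')⟩

/-- The inclusion of the vertex space of the restriction. -/
noncomputable def BRel.restrIncl (K : Type) [Field K] (Γ : BRel) :
    (Γ.restr.S →₀ K) →ₗ[K] (Γ.S →₀ K) :=
  Finsupp.lmapDomain K K Subtype.val

theorem BRel.restrIncl_injective (Γ : BRel) : Function.Injective (Γ.restrIncl K) :=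
  Finsupp.mapDomain_injective Subtype.val_injective

theorem BRel.restrIncl_single (Γ : BRel) (a : Γ.restr.S) (c : K) :
    Γ.restrIncl K (Finsupp.single a c) = Finsupp.single a.1 c :=
  Finsupp.mapDomain_single

theorem BRel.mem_range_restrIncl (Γ : BRel) (y : Γ.S →₀ K) :
    y ∈ LinearMap.range (Γ.restrIncl K) ↔ ∃ x, (x, y) ∈ Γ.lrel K := by
  constructor
  · rintro ⟨z, rfl⟩
    induction z using Finsupp.induction_linear with
    | zero => exact ⟨0, by rw [map_zero]; exact (Γ.lrel K).zero_mem⟩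
    | add f g hf hg =>
      obtain ⟨x, hx⟩ := hf
      obtain ⟨x', hx'⟩ := hg
      exact ⟨x + x', by rw [map_add]; exact (Γ.lrel K).add_mem hx hx'⟩
    | single b c =>
      obtain ⟨a, hab⟩ := b.2
      refine ⟨c • Finsupp.single a 1, ?_⟩
      have := (Γ.lrel K).smul_mem c (BRel.single_mem_lrel hab)
      rw [BRel.restrIncl_single]
      simpa using this
  · rintro ⟨x, hx⟩
    have hle : Γ.lrel K ≤ (LinearMap.range (Γ.restrIncl K)).comap (LinearMap.snd K _ _) := by
      refine Submodule.span_le.2 ?_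
      rintro _ ⟨a, b, hab, rfl⟩
      exact ⟨Finsupp.single ⟨b, a, hab⟩ 1, BRel.restrIncl_single _ _ _⟩
    exact hle hx

theorem BRel.PartialInj.mem_lrel_restr {Γ : BRel} (h : Γ.PartialInj) (v w : Γ.restr.S →₀ K) :
    (v, w) ∈ Γ.restr.lrel K ↔ (Γ.restrIncl K v, Γ.restrIncl K w) ∈ Γ.lrel K := by
  have hmap : ∀ v w : Γ.restr.S →₀ K, (v, w) ∈ Γ.restr.lrel K →
      (Γ.restrIncl K v, Γ.restrIncl K w) ∈ Γ.lrel K := fun v w hvw =>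
    BRel.map_lrel_le (K := K) (Γ := Γ.restr) (Δ := Γ) Subtype.val (fun a b hab => hab)
      ⟨_, hvw, rfl⟩
  refine ⟨hmap v w, fun hvw => ?_⟩
  let res : (Γ.S →₀ K) →ₗ[K] (Γ.restr.S →₀ K) :=
    Finsupp.lcomapDomain Subtype.val Subtype.val_injective
  have hres : ∀ v, res (Γ.restrIncl K v) = v := fun v =>
    Finsupp.ext fun a => Finsupp.mapDomain_apply Subtype.val_injective v a
  have hle : Γ.lrel K ≤
      ((Γ.restr.lrel K).map (LinearMap.fst K _ _)).comap (res ∘ₗ LinearMap.fst K _ _) := by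
    refine Submodule.span_le.2 ?_
    rintro _ ⟨a, b, hab, rfl⟩
    by_cases ha : ∃ x, Γ.R x a
    · refine ⟨_, BRel.single_mem_lrel (Γ := Γ.restr) (a := ⟨a, ha⟩) (b := ⟨b, a, hab⟩) hab, ?_⟩
      exact (hres _).symm.trans (congrArg res (BRel.restrIncl_single _ _ _))
    · have h0 : res (Finsupp.single a 1) = 0 := by
        ext z
        have hz : a ≠ z.1 := by
          rintro rfl
          exact ha z.2
        exact Finsupp.single_eq_of_ne' hz
      refine ⟨0, (Γ.restr.lrel K).zero_mem, ?_⟩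
      exact h0.symm
  obtain ⟨⟨v', w'⟩, hvw', e⟩ := hle hvw
  have e' : v' = v := e.trans (hres v)
  subst e'
  rwa [Γ.restrIncl_injective (h.eq_of_mem_lrel hvw (hmap _ _ hvw'))]

theorem BRel.LIso.restr {Γ Δ : BRel} (h : BRel.LIso K Γ Δ) (hΓ : Γ.PartialInj)
    (hΔ : Δ.PartialInj) : BRel.LIso K Γ.restr Δ.restr := by
  obtain ⟨β, hβ⟩ := h
  obtain ⟨β', hβ'⟩ := exists_linearEquiv_restrict (Γ.restrIncl K) (Δ.restrIncl K)
    Γ.restrIncl_injective Δ.restrIncl_injective β (by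
      intro y
      rw [BRel.mem_range_restrIncl, BRel.mem_range_restrIncl, β.surjective.exists]
      simp only [hβ])
  exact ⟨β', fun x y => by rw [hΓ.mem_lrel_restr, hΔ.mem_lrel_restr, hβ', hβ', hβ]⟩

/-- An isomorphism of the restrictions of partial injections extends. -/
theorem BRel.Iso.of_restr {Γ Δ : BRel} (hΓ : Γ.PartialInj) (hΔ : Δ.PartialInj)
    (hS : Nat.card Γ.S = Nat.card Δ.S) (h : BRel.Iso Γ.restr Δ.restr) : BRel.Iso Γ Δ := by
  classical
  obtain ⟨φ, hφ⟩ := h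
  have := Fintype.ofFinite Γ.S
  have := Fintype.ofFinite Δ.S
  obtain ⟨e⟩ := Finite.card_eq.1 hS
  have hex : ∀ x : Γ.S, ∃ z : Δ.S, (∀ hx : ∃ w, Γ.R w x, z = (φ ⟨x, hx⟩).1) ∧
      ∀ y (hxy : Γ.R x y), Δ.R z (φ ⟨y, x, hxy⟩).1 := by
    intro x
    by_cases hx : ∃ w, Γ.R w x
    · exact ⟨_, fun _ => rfl, fun y hxy => (hφ ⟨x, hx⟩ ⟨y, x, hxy⟩).2 hxy⟩
    · by_cases hy : ∃ y, Γ.R x y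
      · obtain ⟨y, hxy⟩ := hy
        obtain ⟨z, hz⟩ := (φ ⟨y, x, hxy⟩).2
        refine ⟨z, fun hx' => absurd hx' hx, fun y' hxy' => ?_⟩
        obtain rfl := hΓ.1 x y y' hxy hxy'
        exact hz
      · exact ⟨e x, fun hx' => absurd hx' hx, fun y hxy => absurd ⟨y, hxy⟩ hy⟩
  choose f hf1 hf2 using hex
  have hmeet : ∀ x y x' (hx' : ∃ w, Γ.R w x'), Γ.R x y → f x = f x' → x = x' := by
    intro x y x' hx' hxy e
    have h1 := hf2 x y hxy
    rw [e, hf1 x' hx'] at h1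
    exact hΓ.2 _ _ _ hxy ((hφ ⟨x', hx'⟩ ⟨y, x, hxy⟩).1 h1)
  let s : Set Γ.S := {x | (∃ w, Γ.R w x) ∨ ∃ y, Γ.R x y}
  have hinj : Set.InjOn f s := by
    intro x hx x' hx' e
    rcases hx with hx | ⟨y, hxy⟩
    · rcases hx' with hx' | ⟨y', hxy'⟩
      · rw [hf1 x hx, hf1 x' hx'] at e
        exact congrArg Subtype.val (φ.injective (Subtype.ext e))
      · exact (hmeet x' y' x hx hxy' e.symm).symm
    · rcases hx' with hx' | ⟨y', hxy'⟩
      · exact hmeet x y x' hx' hxy e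
      · have h1 := hf2 x y hxy
        have h2 := hf2 x' y' hxy'
        rw [e] at h1
        have h3 : y = y' :=
          congrArg Subtype.val (φ.injective (Subtype.ext (hΔ.1 _ _ _ h1 h2)))
        subst h3
        exact hΓ.2 _ _ _ hxy hxy'
  obtain ⟨g, hg⟩ := Set.MapsTo.exists_equiv_extend_of_card_eq (t := (Finset.univ : Finset Δ.S))
    (by rw [Finset.card_univ]; exact Fintype.card_congr e) (s := s) (f := f)
    (fun _ _ => Finset.mem_coe.2 (Finset.mem_univ _)) hinj
  let g' : Γ.S ≃ Δ.S := g.trans (Equiv.subtypeUnivEquiv Finset.mem_univ)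
  have hg' : ∀ x ∈ s, g' x = f x := hg
  have hfwd : ∀ a b, Γ.R a b → Δ.R (g' a) (g' b) := by
    intro a b hab
    rw [hg' a (Or.inr ⟨b, hab⟩), hg' b (Or.inl ⟨a, hab⟩), hf1 b ⟨a, hab⟩]
    exact hf2 a b hab
  refine ⟨g', fun a b => ⟨fun hab => ?_, hfwd a b⟩⟩
  obtain ⟨⟨b', a₀, hab₀⟩, hb'⟩ := φ.surjective ⟨g' b, g' a, hab⟩
  have hbb : b' = b := by
    apply g'.injective
    rw [hg' b' (Or.inl ⟨a₀, hab₀⟩), hf1 b' ⟨a₀, hab₀⟩, hb']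
  subst hbb
  rwa [g'.injective (hΔ.2 _ _ _ hab (hfwd a₀ b' hab₀))]

theorem BRel.PartialInj.exists_perm {Γ : BRel} (h : Γ.PartialInj)
    (hsurj : ∀ y, ∃ x, Γ.R x y) : ∃ f : Equiv.Perm Γ.S, ∀ x y, Γ.R x y ↔ x = f y := by
  choose p hp using hsurj
  have hinj : Function.Injective p := fun y y' e => h.1 (p y) y y' (hp y) (e ▸ hp y')
  refine ⟨Equiv.ofBijective p (Finite.injective_iff_bijective.1 hinj),
    fun x y => ⟨fun hxy => ?_, ?_⟩⟩
  · exact h.2 _ _ _ hxy (hp y)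
  · rintro rfl
    exact hp y

theorem BRel.lmapDomain_mem_lrel {Γ : BRel} {f : Γ.S → Γ.S} (hf : ∀ y, Γ.R (f y) y)
    (y : Γ.S →₀ K) : (Finsupp.lmapDomain K K f y, y) ∈ Γ.lrel K := by
  induction y using Finsupp.induction_linear with
  | zero => exact (Γ.lrel K).zero_mem
  | add y y' hy hy' =>
    rw [map_add]
    exact (Γ.lrel K).add_mem hy hy'
  | single b c =>
    have := (Γ.lrel K).smul_mem c (BRel.single_mem_lrel (hf b))
    simpa using this

theorem BRel.card_restr_lt {Γ : BRel} (h : ¬ ∀ y, ∃ x, Γ.R x y) :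
    Nat.card Γ.restr.S < Nat.card Γ.S := by
  push Not at h
  obtain ⟨y, hy⟩ := h
  exact Finite.card_subtype_lt (x := y) (by simpa using hy)

/-- Partial injections spanning isomorphic linear relations are isomorphic. -/
theorem BRel.LIso.iso {Γ Δ : BRel} (h : BRel.LIso K Γ Δ) (hΓ : Γ.PartialInj)
    (hΔ : Δ.PartialInj) : BRel.Iso Γ Δ := by
  induction hc : Nat.card Γ.S using Nat.strong_induction_on generalizing Γ Δ with
  | _ c ih =>
    subst hc
    by_cases hsΓ : ∀ y, ∃ x, Γ.R x y
    · have hsΔ : ∀ y, ∃ x, Δ.R x y := by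
        by_contra hn
        have h1 := BRel.card_restr_lt hn
        rw [← (h.restr hΓ hΔ).card_eq, ← h.card_eq] at h1
        exact h1.ne (Nat.card_congr (Equiv.subtypeUnivEquiv hsΓ))
      obtain ⟨f, hf⟩ := hΓ.exists_perm hsΓ
      obtain ⟨g, hg⟩ := hΔ.exists_perm hsΔ
      obtain ⟨β, hβ⟩ := h
      obtain ⟨φ, hφ⟩ := exists_equiv_semiconj f g β fun y => hΔ.eq_of_mem_lrel'
        ((hβ _ _).2 (BRel.lmapDomain_mem_lrel (fun y => (hf _ y).2 rfl) y))
        (BRel.lmapDomain_mem_lrel (fun y => (hg _ y).2 rfl) (β y))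
      exact ⟨φ, fun a b => by rw [hf, hg, ← hφ, φ.injective.eq_iff]⟩
    · exact BRel.Iso.of_restr hΓ hΔ h.card_eq
        (ih _ (BRel.card_restr_lt hsΓ) (h.restr hΓ hΔ) hΓ.restr hΔ.restr rfl)

end PartialInjections

/-- `K(Γ) ≅ K(Γ')` iff `γ_{i,j}(Γ) = γ_{i,j}(Γ')` for `|i−j| ≤ 2`,
the C-stabilizations are graph-isomorphic, and `Γ` and `Γ'` have the same number of
edges. -/
theorem stmt14 (K : Type) [Field K] (Γ Γ' : BRel) :
    Pair.Iso K (Γ.linz K) (Γ'.linz K) ↔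
      ((∀ i j : ℕ, |(i : ℤ) - (j : ℤ)| ≤ 2 → Γ.gamma i j = Γ'.gamma i j) ∧
       (∃ N N', Γ.StabAt N ∧ Γ'.StabAt N' ∧
         BRel.Iso (BRel.Cl^[N] (BRel.Cr^[N] Γ)) (BRel.Cl^[N'] (BRel.Cr^[N'] Γ'))) ∧
       Γ.edges = Γ'.edges) := by
  rw [BRel.linz_iso_iff, ← and_assoc]
  refine and_congr_left' ⟨fun h => ?_, ?_⟩
  · refine ⟨fun i j _ => (h.contract i j).card_eq, ?_⟩
    obtain ⟨N, hN⟩ := Γ.exists_stabAt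
    obtain ⟨N', hN'⟩ := Γ'.exists_stabAt
    refine ⟨N, N', hN, hN', BRel.LIso.iso (K := K) ?_ hN.partialInj hN'.partialInj⟩
    exact ((hN.iso (le_max_left N N')).lIso.symm.trans (h.contract _ _)).trans
      (hN'.iso (le_max_right N N')).lIso
  · rintro ⟨hγ, N, N', hN, hN', hiso⟩
    exact BRel.LIso.of_contract hγ (max N N')
      (((hN.iso (le_max_left N N')).trans hiso).trans (hN'.iso (le_max_right N N')).symm).lIso

end Towber
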